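/- Let ρ_{ABCD} be a pure four-party quantum state such that (1) I(A;B|C) = 0, (2) the reduced state ρ_{AB} is maximally mixed, and (3) |A||B| = |C||D|. Then there exist tensor product decompositions A = A_L⊗A_R, B = B_L⊗B_R, C = C_L⊗C_R, D = D_L⊗D_R such that ρ_{ABCD} = Φ⁺_{A_L C_L} ⊗ Φ⁺_{A_R D_L} ⊗ Φ⁺_{B_L C_R} ⊗ Φ⁺_{B_R D_R}, where each Φ⁺ denotes a maximally entangled pure state between the two indicated subsystems. -/

import Mathlib

open Matrix Kronecker Filter
open scoped BigOperators Classical ComplexOrder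

noncomputable section

namespace Scrambling

/-- The maximally mixed state on a finite-dimensional system `X`. -/
def mmState (X : Type*) [Fintype X] [DecidableEq X] : Matrix X X ℂ :=
  (Fintype.card X : ℂ)⁻¹ • 1

/-- A (possibly rectangular) matrix is unitary if `U Uᴴ = 1` and `Uᴴ U = 1`. -/
def IsUnitaryMat {m n : Type*} [Fintype m] [Fintype n] [DecidableEq m] [DecidableEq n]
    (U : Matrix m n ℂ) : Prop :=
  U * Uᴴ = 1 ∧ Uᴴ * U = 1

/-- Reduced density matrix of a pure state `ψ` on `X ⊗ Y`, tracing out `Y`. -/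
def redDM {X Y : Type*} [Fintype Y] (ψ : X × Y → ℂ) : Matrix X X ℂ :=
  Matrix.of fun x x' => ∑ y, ψ (x, y) * star (ψ (x', y))

/-- Base-2 von Neumann entropy of a (Hermitian) matrix: `S(ρ) = -tr (ρ log₂ ρ)`,
computed via the eigenvalues. Junk value `0` for non-Hermitian matrices. -/
def vNE {n : Type*} [Fintype n] [DecidableEq n] (ρ : Matrix n n ℂ) : ℝ :=
  if h : ρ.IsHermitian then (∑ i, Real.negMulLog (h.eigenvalues i)) / Real.log 2 else 0

/-- Trace norm `‖X‖₁ = tr √(XᴴX)`, via the eigenvalues of `XᴴX`. -/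
def traceNorm {n : Type*} [Fintype n] [DecidableEq n] (X : Matrix n n ℂ) : ℝ :=
  ∑ i, Real.sqrt ((Matrix.posSemidef_conjTranspose_mul_self X).1.eigenvalues i)

/-- Density matrix: positive semidefinite with unit trace. -/
def IsDensityMatrix {n : Type*} [Fintype n] (ρ : Matrix n n ℂ) : Prop :=
  ρ.PosSemidef ∧ ρ.trace = 1

/-- The pure density matrix `|ψ⟩⟨ψ|` associated to a state vector. -/
def pureDM {T : Type*} (ψ : T → ℂ) : Matrix T T ℂ :=
  Matrix.of fun x y => ψ x * star (ψ y)

/-- Extension `id_R ⊗ Φ` of a (linear) map `Φ` on matrices to a reference system `R`. -/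
def extendCh {R A C : Type*} (Φ : Matrix A A ℂ → Matrix C C ℂ)
    (ρ : Matrix (R × A) (R × A) ℂ) : Matrix (R × C) (R × C) ℂ :=
  Matrix.of fun p q => Φ (Matrix.of fun x y => ρ (p.1, x) (q.1, y)) p.2 q.2

/-- Diamond-norm distance between two (linear) maps on matrices:
the supremum over all finite-dimensional reference systems `R = Fin n` and all density
matrices `ρ` on `R ⊗ A` of the trace norm of the difference of the extended outputs. -/
def diamondDist {A C : Type*} [Fintype A] [DecidableEq A] [Fintype C] [DecidableEq C]
    (Φ Ψ : Matrix A A ℂ → Matrix C C ℂ) : ℝ :=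
  sSup {x | ∃ (n : ℕ) (ρ : Matrix (Fin n × A) (Fin n × A) ℂ),
    IsDensityMatrix ρ ∧ x = traceNorm (extendCh Φ ρ - extendCh Ψ ρ)}

/-- The unitary quantum channel `σ ↦ U σ Uᴴ`. -/
def uChannel {m n : Type*} [Fintype m] [Fintype n] (U : Matrix m n ℂ) : Matrix n n ℂ → Matrix m m ℂ :=
  fun σ => U * σ * Uᴴ

/-- The completely depolarizing channel `σ ↦ tr(σ) · τ_C`. -/
def depol (A C : Type*) [Fintype A] [Fintype C] [DecidableEq C] :
    Matrix A A ℂ → Matrix C C ℂ :=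
  fun σ => σ.trace • mmState C

section FourParty

variable {A B C D : Type*} [Fintype A] [Fintype B] [Fintype C] [Fintype D]
  [DecidableEq A] [DecidableEq B] [DecidableEq C] [DecidableEq D]

/-- State vector of the Choi state of a bipartite unitary `U : AB → CD`:
`|U⟩ = (1 ⊗ U)(|Φ⁺⟩_{AA'} ⊗ |Φ⁺⟩_{BB'})`. -/
def choiVec (U : Matrix (C × D) (A × B) ℂ) : (A × B) × C × D → ℂ :=
  fun p => (Real.sqrt (Fintype.card A * Fintype.card B) : ℂ)⁻¹ * U p.2 p.1

/-- Density matrix of the Choi state of a bipartite unitary. -/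
def choiDM (U : Matrix (C × D) (A × B) ℂ) :
    Matrix ((A × B) × C × D) ((A × B) × C × D) ℂ :=
  pureDM (choiVec U)

variable (ψ : (A × B) × C × D → ℂ)

/-- Reduced density matrices of a four-party pure state on `A ⊗ B ⊗ C ⊗ D`. -/
def rhoA : Matrix A A ℂ :=
  redDM fun p : A × (B × C × D) => ψ ((p.1, p.2.1), (p.2.2.1, p.2.2.2))

def rhoB : Matrix B B ℂ :=
  redDM fun p : B × (A × C × D) => ψ ((p.2.1, p.1), (p.2.2.1, p.2.2.2))

def rhoC : Matrix C C ℂ :=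
  redDM fun p : C × (A × B × D) => ψ ((p.2.1, p.2.2.1), (p.1, p.2.2.2))

def rhoD : Matrix D D ℂ :=
  redDM fun p : D × (A × B × C) => ψ ((p.2.1, p.2.2.1), (p.2.2.2, p.1))

def rhoAB : Matrix (A × B) (A × B) ℂ := redDM ψ

def rhoAC : Matrix (A × C) (A × C) ℂ :=
  redDM fun p : (A × C) × B × D => ψ ((p.1.1, p.2.1), (p.1.2, p.2.2))

def rhoAD : Matrix (A × D) (A × D) ℂ :=
  redDM fun p : (A × D) × B × C => ψ ((p.1.1, p.2.1), (p.2.2, p.1.2))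

def rhoBC : Matrix (B × C) (B × C) ℂ :=
  redDM fun p : (B × C) × A × D => ψ ((p.2.1, p.1.1), (p.1.2, p.2.2))

def rhoBD : Matrix (B × D) (B × D) ℂ :=
  redDM fun p : (B × D) × A × C => ψ ((p.2.1, p.1.1), (p.2.2, p.1.2))

def rhoCD : Matrix (C × D) (C × D) ℂ :=
  redDM fun p : (C × D) × A × B => ψ (p.2, p.1)

def rhoABC : Matrix ((A × B) × C) ((A × B) × C) ℂ :=
  redDM fun p : ((A × B) × C) × D => ψ (p.1.1, (p.1.2, p.2))

def rhoABD : Matrix ((A × B) × D) ((A × B) × D) ℂ :=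
  redDM fun p : ((A × B) × D) × C => ψ (p.1.1, (p.2, p.1.2))

def rhoACD : Matrix (A × C × D) (A × C × D) ℂ :=
  redDM fun p : (A × C × D) × B => ψ ((p.1.1, p.2), p.1.2)

def rhoBCD : Matrix (B × C × D) (B × C × D) ℂ :=
  redDM fun p : (B × C × D) × A => ψ ((p.2, p.1.1), p.1.2)

/-- Subsystem von Neumann entropies. -/
def SA : ℝ := vNE (rhoA ψ)
def SB : ℝ := vNE (rhoB ψ)
def SC : ℝ := vNE (rhoC ψ)
def SD : ℝ := vNE (rhoD ψ)
def SAB : ℝ := vNE (rhoAB ψ)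
def SAC : ℝ := vNE (rhoAC ψ)
def SAD : ℝ := vNE (rhoAD ψ)
def SBC : ℝ := vNE (rhoBC ψ)
def SBD : ℝ := vNE (rhoBD ψ)
def SCD : ℝ := vNE (rhoCD ψ)
def SABC : ℝ := vNE (rhoABC ψ)
def SABD : ℝ := vNE (rhoABD ψ)
def SACD : ℝ := vNE (rhoACD ψ)
def SBCD : ℝ := vNE (rhoBCD ψ)

/-- Mutual informations `I(X;Y) = S(X) + S(Y) - S(XY)`. -/
def IAB : ℝ := SA ψ + SB ψ - SAB ψ
def IAC : ℝ := SA ψ + SC ψ - SAC ψ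
def IAD : ℝ := SA ψ + SD ψ - SAD ψ
def IBC : ℝ := SB ψ + SC ψ - SBC ψ
def IBD : ℝ := SB ψ + SD ψ - SBD ψ
def ICD : ℝ := SC ψ + SD ψ - SCD ψ
def IACD : ℝ := SA ψ + SCD ψ - SACD ψ

/-- Tripartite information `I₃(A;C;D) = I(A;C) + I(A;D) - I(A;CD)`. -/
def I3ACD : ℝ := IAC ψ + IAD ψ - IACD ψ

/-- Conditional mutual informations. -/
def cmiAB_C : ℝ := SAC ψ + SBC ψ - SC ψ - SABC ψ
def cmiAB_D : ℝ := SAD ψ + SBD ψ - SD ψ - SABD ψ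
def cmiCD_A : ℝ := SAC ψ + SAD ψ - SA ψ - SACD ψ
def cmiCD_B : ℝ := SBC ψ + SBD ψ - SB ψ - SBCD ψ

/-- Rényi-2 entropy `S₂(ρ) = -log₂ tr ρ²`. -/
def S2 {n : Type*} [Fintype n] (ρ : Matrix n n ℂ) : ℝ :=
  -Real.logb 2 ((ρ * ρ).trace.re)

/-- Rényi-2 tripartite information `I₃⁽²⁾ = S₂(A) + S₂(B) - S₂(AC) - S₂(AD)`. -/
def I3r2 : ℝ := S2 (rhoA ψ) + S2 (rhoB ψ) - S2 (rhoAC ψ) - S2 (rhoAD ψ)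

end FourParty

/-- The residual channel `N_{A→C}(σ) = tr_D [U (σ ⊗ τ_B) Uᴴ]`. -/
def residual {A B C D : Type*} [Fintype A] [Fintype B] [Fintype C] [Fintype D]
    [DecidableEq A] [DecidableEq B]
    (U : Matrix (C × D) (A × B) ℂ) (σ : Matrix A A ℂ) : Matrix C C ℂ :=
  Matrix.of fun c c' => ∑ d, (U * (σ ⊗ₖ mmState B) * Uᴴ) (c, d) (c', d)

/-- A unitary on `X ⊗ X` is a perfect tensor iff all two-party marginals of its
Choi state are maximally mixed. -/
def PerfectTensor {X : Type*} [Fintype X] [DecidableEq X]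
    (U : Matrix (X × X) (X × X) ℂ) : Prop :=
  rhoAB (choiVec U) = mmState (X × X) ∧ rhoAC (choiVec U) = mmState (X × X) ∧
  rhoAD (choiVec U) = mmState (X × X) ∧ rhoBC (choiVec U) = mmState (X × X) ∧
  rhoBD (choiVec U) = mmState (X × X) ∧ rhoCD (choiVec U) = mmState (X × X)

/-- The unitary `U_d` which acts as `U_S` on the subspace spanned by the first `d_S`
basis vectors of each tensor factor, and as the identity otherwise. -/
def embedU (dS d : ℕ) (h : dS ≤ d) (US : Matrix (Fin dS × Fin dS) (Fin dS × Fin dS) ℂ) :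
    Matrix (Fin d × Fin d) (Fin d × Fin d) ℂ :=
  Matrix.of fun o i =>
    if hi : i.1.val < dS ∧ i.2.val < dS then
      if ho : o.1.val < dS ∧ o.2.val < dS then
        US (⟨o.1.val, ho.1⟩, ⟨o.2.val, ho.2⟩) (⟨i.1.val, hi.1⟩, ⟨i.2.val, hi.2⟩)
      else 0
    else if o = i then 1 else 0


/-- Density matrix entries of a maximally entangled pair between two copies of `Fin t`:
`Φ⁺` has `⟨x y|Φ⁺|x' y'⟩ = δ_{xy} δ_{x'y'} / t`. -/
def pairME {X : Type*} [Fintype X] [DecidableEq X] (x y x' y' : X) : ℂ :=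
  if x = y ∧ x' = y' then (Fintype.card X : ℂ)⁻¹ else 0

/-- The four-party state `Φ⁺_{A_L C_L} ⊗ Φ⁺_{A_R D_L} ⊗ Φ⁺_{B_L C_R} ⊗ Φ⁺_{B_R D_R}`
with `A = A_L ⊗ A_R = Fin p × Fin q`, `B = Fin r × Fin s`, `C = Fin p × Fin r`,
`D = Fin q × Fin s`. -/
def fourEPR (p q r s : ℕ) :
    Matrix (((Fin p × Fin q) × Fin r × Fin s) × (Fin p × Fin r) × Fin q × Fin s)
           (((Fin p × Fin q) × Fin r × Fin s) × (Fin p × Fin r) × Fin q × Fin s) ℂ :=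
  Matrix.of fun P Q =>
    pairME P.1.1.1 P.2.1.1 Q.1.1.1 Q.2.1.1 * pairME P.1.1.2 P.2.2.1 Q.1.1.2 Q.2.2.1 *
    pairME P.1.2.1 P.2.1.2 Q.1.2.1 Q.2.1.2 * pairME P.1.2.2 P.2.2.2 Q.1.2.2 Q.2.2.2


lemma hopf_const (G : ℂ → ℂ) (hG : Differentiable ℂ G)
    (hb : ∀ z : ℂ, 0 ≤ z.re → z.re ≤ 1/2 → ‖G z‖ ≤ 1) (h0 : G 0 = 1) (h1 : deriv G 0 = 0) :
    ∀ z, G z = 1 := by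
  have han : AnalyticAt ℂ (fun z => G z - 1) 0 := (hG.analyticAt 0).sub analyticAt_const
  by_cases hev : ∀ᶠ z in nhds 0, G z - 1 = 0
  · have h2 : G = fun _ => 1 := by
      refine AnalyticOnNhd.eq_of_eventuallyEq (𝕜 := ℂ) (z₀ := 0) (fun z _ => hG.analyticAt z)
        (fun z _ => analyticAt_const) ?_
      filter_upwards [hev] with z hz
      exact sub_eq_zero.mp hz
    intro z
    rw [h2]
  · exfalso
    obtain ⟨k, g, hg, hg0, hgeq⟩ := han.exists_eventuallyEq_pow_smul_nonzero_iff.mpr hev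
    have hd1 : HasDerivAt (fun z => G z - 1) 0 0 := by
      have := (hG 0).hasDerivAt.sub_const (1:ℂ)
      rwa [h1] at this
    have hk : 2 ≤ k := by
      rcases Nat.lt_or_ge k 2 with h | h
      · interval_cases k
        · have := hgeq.self_of_nhds
          simp [h0] at this
          exact absurd this.symm hg0
        · have h3 : HasDerivAt (fun z => (z - 0)^1 • g z) (g 0) 0 := by
            have := ((hasDerivAt_id (0:ℂ)).mul hg.differentiableAt.hasDerivAt)
            simp at this
            simp only [sub_zero, pow_one, smul_eq_mul]
            exact this
          have h4 : HasDerivAt (fun z => G z - 1) (g 0) 0 := h3.congr_of_eventuallyEq hgeq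
          exact absurd (h4.unique hd1) hg0
      · exact h
    set α := (g 0).arg with hα
    have hαle : |α| ≤ Real.pi := Complex.abs_arg_le_pi _
    have hkR : (2:ℝ) ≤ k := by exact_mod_cast hk
    set φ : ℝ := -α / (k+1) with hφ
    have habs : |φ| ≤ Real.pi / 3 := by
      rw [hφ, abs_div, abs_neg, abs_of_pos (by positivity : (0:ℝ) < k+1)]
      exact div_le_div₀ Real.pi_pos.le hαle (by norm_num) (by linarith)
    have hφ' := abs_le.mp habs
    have hpi := Real.pi_pos
    set u : ℂ := Complex.exp (φ * Complex.I) with hu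
    have hure : 0 < u.re := by
      rw [hu, Complex.exp_ofReal_mul_I_re]
      exact Real.cos_pos_of_mem_Ioo ⟨by linarith, by linarith⟩
    have hupos : 0 < (u^k * g 0).re := by
      have e1 : u^k * g 0 = (‖g 0‖ : ℂ) * Complex.exp (((-φ : ℝ) : ℂ) * Complex.I) := by
        conv_lhs => rw [← Complex.norm_mul_exp_arg_mul_I (g 0)]
        rw [hu, ← Complex.exp_nat_mul, mul_left_comm, ← Complex.exp_add]
        congr 2
        rw [← hα, hφ]
        have : ((k:ℂ)+1) ≠ 0 := by exact_mod_cast Nat.succ_ne_zero k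
        push_cast
        field_simp
        ring
      rw [e1, Complex.re_ofReal_mul, Complex.exp_ofReal_mul_I_re, Real.cos_neg]
      have := Real.cos_pos_of_mem_Ioo (x := φ) ⟨by linarith, by linarith⟩
      have : 0 < ‖g 0‖ := norm_pos_iff.mpr hg0
      positivity
    have hpath : Tendsto (fun s : ℝ => (s : ℂ) * u) (nhdsWithin 0 (Set.Ioi 0)) (nhds 0) := by
      have : Continuous (fun s : ℝ => (s : ℂ) * u) := by fun_prop
      have h := this.tendsto 0
      simp only [Complex.ofReal_zero, zero_mul] at h
      exact h.mono_left nhdsWithin_le_nhds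
    have hcont : Tendsto (fun z => (u^k * g z).re) (nhds 0) (nhds ((u^k * g 0).re)) :=
      (Complex.continuous_re.tendsto _).comp ((hg.continuousAt.tendsto).const_mul _)
    have hA := hpath.eventually hgeq
    have hB := (hcont.comp hpath).eventually (lt_mem_nhds hupos)
    have hC : ∀ᶠ s : ℝ in nhdsWithin 0 (Set.Ioi 0), s * u.re ≤ 1/2 := by
      have : Continuous (fun s : ℝ => s * u.re) := by fun_prop
      have h := (this.tendsto 0).mono_left (nhdsWithin_le_nhds (s := Set.Ioi 0))
      simp only [zero_mul] at h
      filter_upwards [h.eventually (gt_mem_nhds (by norm_num : (0:ℝ) < 1/2))] with s hs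
      exact hs.le
    have hD : ∀ᶠ s : ℝ in nhdsWithin 0 (Set.Ioi 0), 0 < s := self_mem_nhdsWithin
    obtain ⟨s, hs1, hs2, hs3, hs4⟩ := (hA.and (hB.and (hC.and hD))).exists
    have hre : ((s:ℂ) * u).re = s * u.re := by simp
    have hn := hb (s*u) (by rw [hre]; positivity) (by rw [hre]; exact hs3)
    have hn2 := (Complex.re_le_norm (G (s*u))).trans hn
    have e3 : G (s*u) = 1 + ((s^k : ℝ) : ℂ) * (u^k * g (s*u)) := by
      have : G (s*u) = 1 + (G (s*u) - 1) := by ring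
      rw [this, hs1]; push_cast; simp; ring
    rw [e3, Complex.add_re, Complex.re_ofReal_mul, Complex.one_re] at hn2
    have : 0 < s^k * (u^k * g (s*u)).re := mul_pos (by positivity) hs2
    linarith


/-- `x ^ z` with the convention `0 ^ z = 0`. -/
def fpow (x : ℝ) (z : ℂ) : ℂ := if x = 0 then 0 else Complex.exp (z * (Real.log x : ℂ))

lemma fpow_diff (x : ℝ) : Differentiable ℂ (fpow x) := by
  unfold fpow
  split_ifs <;> fun_prop

lemma fpow_deriv (x : ℝ) : HasDerivAt (fpow x) ((Real.log x : ℂ) * fpow x 0) 0 := by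
  by_cases h : x = 0
  · have : fpow x = fun _ => 0 := by ext z; simp [fpow, h]
    rw [this]; simpa using hasDerivAt_const (0:ℂ) (0:ℂ)
  · have : fpow x = fun z => Complex.exp (z * (Real.log x : ℂ)) := by ext z; simp [fpow, h]
    rw [this]
    have := ((hasDerivAt_id (0:ℂ)).mul_const (Real.log x : ℂ)).cexp
    simpa using this

lemma fpow_star_mul (x : ℝ) (z : ℂ) :
    star (fpow x z) * fpow x z = fpow x ((2 * z.re : ℝ) : ℂ) := by
  unfold fpow
  split_ifs
  · simp
  · simp only [Complex.star_def, ← Complex.exp_conj, ← Complex.exp_add]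
    congr 1
    apply Complex.ext <;> simp <;> ring

lemma fpow_zero' (x : ℝ) : fpow x 0 = if x = 0 then 0 else 1 := by simp [fpow]

lemma fpow_one (x : ℝ) (hx : 0 ≤ x) : fpow x 1 = x := by
  unfold fpow
  split_ifs with h
  · simp [h]
  · rw [one_mul, ← Complex.ofReal_exp, Real.exp_log (lt_of_le_of_ne hx (Ne.symm h))]

lemma fpow_norm_le (x : ℝ) (z : ℂ) (h0 : 0 ≤ z.re) (h1 : z.re ≤ 1/2) :
    ‖fpow x z‖ ≤ Real.exp |Real.log x| := by
  unfold fpow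
  split_ifs
  · simp; positivity
  · rw [Complex.norm_exp]
    apply Real.exp_le_exp.mpr
    simp only [Complex.mul_re, Complex.ofReal_re, Complex.ofReal_im, mul_zero, sub_zero]
    calc z.re * Real.log x ≤ z.re * |Real.log x| :=
          mul_le_mul_of_nonneg_left (le_abs_self _) h0
      _ ≤ 1 * |Real.log x| := mul_le_mul_of_nonneg_right (by linarith) (abs_nonneg _)
      _ = _ := one_mul _

section core
variable {n : Type*} [Fintype n] [DecidableEq n]

lemma trace_diag_expand (u v : n → ℂ) (S R : Matrix n n ℂ) :
    trace (diagonal u * S * diagonal v * R) = ∑ i, ∑ j, u i * v j * (S i j * R j i) := by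
  simp only [trace, diag_apply, mul_apply (M := diagonal u * S * diagonal v), mul_diagonal,
    diagonal_mul]
  refine Finset.sum_congr rfl fun i _ => Finset.sum_congr rfl fun j _ => by ring

/-- Frobenius norm squared. -/
lemma trace_self_re {m k : Type*} [Fintype m] [Fintype k] (M : Matrix m k ℂ) :
    trace (Mᴴ * M) = ((∑ i, ∑ j, Complex.normSq (M j i) : ℝ) : ℂ) := by
  simp only [trace, diag_apply, mul_apply, conjTranspose_apply, Complex.ofReal_sum,
    Complex.normSq_eq_conj_mul_self, Complex.star_def]

lemma eq_zero_of_trace {m k : Type*} [Fintype m] [Fintype k] (M : Matrix m k ℂ)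
    (h : trace (Mᴴ * M) = 0) : M = 0 :=
  Matrix.trace_conjTranspose_mul_self_eq_zero_iff.mp h

lemma cs_trace (M N : Matrix n n ℂ) (s t : ℝ) (hs : trace (Mᴴ * M) = s) (ht : trace (Nᴴ * N) = t) :
    ‖trace (Mᴴ * N)‖ ^ 2 ≤ s * t := by
  let v : EuclideanSpace ℂ (n × n) := WithLp.toLp 2 fun p => M p.1 p.2
  let w : EuclideanSpace ℂ (n × n) := WithLp.toLp 2 fun p => N p.1 p.2
  have h1 : ∀ P Q : Matrix n n ℂ, trace (Pᴴ * Q) =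
      inner ℂ (WithLp.toLp 2 fun p : n × n => P p.1 p.2 : EuclideanSpace ℂ (n × n))
        (WithLp.toLp 2 fun p : n × n => Q p.1 p.2) := by
    intro P Q
    simp only [trace, diag_apply, mul_apply, conjTranspose_apply, PiLp.inner_apply,
      Fintype.sum_prod_type, RCLike.inner_apply, Complex.star_def]
    rw [Finset.sum_comm]
    exact Finset.sum_congr rfl fun i _ => Finset.sum_congr rfl fun j _ => mul_comm _ _
  have hv : ‖v‖^2 = s := by
    have := h1 M M
    rw [hs, inner_self_eq_norm_sq_to_K] at this
    exact Complex.ofReal_injective (by simpa using this.symm)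
  have hw : ‖w‖^2 = t := by
    have := h1 N N
    rw [ht, inner_self_eq_norm_sq_to_K] at this
    exact Complex.ofReal_injective (by simpa using this.symm)
  rw [h1, ← hv, ← hw, ← mul_pow]
  exact pow_le_pow_left₀ (norm_nonneg _) (norm_inner_le_norm v w) 2

/-- diagonal function calculus -/
def dfc (U : Matrix n n ℂ) (u : n → ℂ) : Matrix n n ℂ := U * diagonal u * Uᴴ

lemma dfc_mul {U : Matrix n n ℂ} (hU : Uᴴ * U = 1) (u v : n → ℂ) :
    dfc U u * dfc U v = dfc U (fun i => u i * v i) := by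
  unfold dfc
  calc _ = U * diagonal u * (Uᴴ * U) * diagonal v * Uᴴ := by simp only [Matrix.mul_assoc]
    _ = _ := by rw [hU, Matrix.mul_one, Matrix.mul_assoc U, diagonal_mul_diagonal]

lemma dfc_conj (U : Matrix n n ℂ) (u : n → ℂ) : (dfc U u)ᴴ = dfc U (fun i => star (u i)) := by
  unfold dfc
  simp [conjTranspose_mul, diagonal_conjTranspose, Matrix.mul_assoc]
  rfl

lemma dfc_add (U : Matrix n n ℂ) (u v : n → ℂ) :
    dfc U u + dfc U v = dfc U (fun i => u i + v i) := by
  unfold dfc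
  rw [← Matrix.add_mul, ← Matrix.mul_add, diagonal_add]

lemma dfc_one {U : Matrix n n ℂ} (hU' : U * Uᴴ = 1) : dfc U (fun _ => 1) = 1 := by
  simp [dfc, hU']

/-- support -/
lemma supp_of_trace {P Pj : Matrix n n ℂ} (hP : Pᴴ = P) (hPP : P * P = P) (hPj : Pjᴴ = Pj)
    (hPjPj : Pj * Pj = Pj) (h : trace (Pj * P) = trace Pj) : P * Pj = Pj := by
  have : Pj - P * Pj = 0 := by
    apply eq_zero_of_trace
    rw [conjTranspose_sub, conjTranspose_mul, hP, hPj]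
    have : (Pj - Pj * P) * (Pj - P * Pj) = Pj * Pj - Pj * P * Pj - Pj * P * Pj + Pj * (P * P) * Pj := by
      noncomm_ring
    rw [this, hPP, hPjPj, sub_add_cancel, trace_sub, Matrix.mul_assoc, trace_mul_comm, Matrix.mul_assoc, hPjPj,
      trace_mul_comm, h, sub_self]
  exact (sub_eq_zero.mp this).symm

set_option maxHeartbeats 1000000 in
theorem core (Pj U W : Matrix n n ℂ) (hPj : Pjᴴ = Pj) (hPjPj : Pj * Pj = Pj)
    (c d : ℝ) (hc : 0 < c) (hd : 0 < d) (htr : trace Pj = d)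
    (hU : Uᴴ * U = 1) (hW : Wᴴ * W = 1)
    (x y : n → ℝ) (hx : ∀ i, 0 ≤ x i) (hy : ∀ i, 0 ≤ y i)
    (hxs : trace (Pj * dfc U (fun i => fpow (x i) 0)) = d)
    (hys : trace (Pj * dfc W (fun i => fpow (y i) 0)) = d)
    (hxy : trace (dfc U (fun i => (x i : ℂ)) * dfc W (fun i => (y i : ℂ))) = (c⁻¹ : ℝ))
    (hent : trace (Pj * dfc U (fun i => (Real.log (x i) : ℂ)))
      + trace (Pj * dfc W (fun i => (Real.log (y i) : ℂ))) = -(d * Real.log (c * d) : ℝ)) :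
    Pj = ((Real.sqrt (c*d) : ℝ) : ℂ) • (dfc U (fun i => fpow (x i) (1/2)) * dfc W (fun i => fpow (y i) (1/2))) := by
  set X : ℂ → Matrix n n ℂ := fun z => dfc U (fun i => fpow (x i) z) with hX
  set Y : ℂ → Matrix n n ℂ := fun z => dfc W (fun i => fpow (y i) z) with hY
  have f0 : ∀ t : ℝ, star (fpow t 0) = fpow t 0 := by
    intro t; rw [fpow_zero']; split_ifs <;> simp
  have f00 : ∀ t : ℝ, fpow t 0 * fpow t 0 = fpow t 0 := by
    intro t; rw [fpow_zero']; split_ifs <;> simp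
  have fl : ∀ t : ℝ, (Real.log t : ℂ) * fpow t 0 = Real.log t := by
    intro t; rw [fpow_zero']; split_ifs with h <;> simp [h]
  have hX0 : X 0 * Pj = Pj := supp_of_trace (by simp only [hX, dfc_conj, f0])
    (by simp only [hX, dfc_mul hU, f00]) hPj hPjPj (hxs.trans htr.symm)
  have hY0 : Y 0 * Pj = Pj := supp_of_trace (by simp only [hY, dfc_conj, f0])
    (by simp only [hY, dfc_mul hW, f00]) hPj hPjPj (hys.trans htr.symm)
  have hX0' : Pj * X 0 = Pj := by
    have := congrArg conjTranspose hX0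
    simpa only [conjTranspose_mul, hPj, hX, dfc_conj, f0] using this
  have hXX : ∀ z, (X z)ᴴ * X z = X ((2 * z.re : ℝ) : ℂ) := by
    intro z
    simp only [hX, dfc_conj, dfc_mul hU, fpow_star_mul]
  have hXX' : ∀ z, X z * (X z)ᴴ = X ((2 * z.re : ℝ) : ℂ) := by
    intro z
    simp only [hX, dfc_conj, dfc_mul hU]
    simp only [mul_comm (fpow _ _), fpow_star_mul]
  have hYY : ∀ z, (Y z)ᴴ * Y z = Y ((2 * z.re : ℝ) : ℂ) := by
    intro z
    simp only [hY, dfc_conj, dfc_mul hW, fpow_star_mul]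
  have hYY' : ∀ z, Y z * (Y z)ᴴ = Y ((2 * z.re : ℝ) : ℂ) := by
    intro z
    simp only [hY, dfc_conj, dfc_mul hW]
    simp only [mul_comm (fpow _ _), fpow_star_mul]
  have hX1 : X 1 = dfc U (fun i => (x i : ℂ)) := by simp only [hX, fpow_one _ (hx _)]
  have hY1 : Y 1 = dfc W (fun i => (y i : ℂ)) := by simp only [hY, fpow_one _ (hy _)]
  set F : ℂ → ℂ := fun z => trace (Pj * (X z * Y z)) with hF
  have key : ∀ u v : n → ℂ, trace (Pj * (dfc U u * dfc W v)) =
      ∑ i, ∑ j, u i * v j * ((Uᴴ * W) i j * (Wᴴ * Pj * U) j i) := by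
    intro u v
    rw [← trace_diag_expand]
    unfold dfc
    rw [show Pj * (U * diagonal u * Uᴴ * (W * diagonal v * Wᴴ)) =
      (Pj * U) * (diagonal u * (Uᴴ * W) * diagonal v * Wᴴ) by simp only [Matrix.mul_assoc],
      trace_mul_comm]
    simp only [Matrix.mul_assoc]
  have hFs : F = fun z => ∑ i, ∑ j, fpow (x i) z * fpow (y j) z * ((Uᴴ * W) i j * (Wᴴ * Pj * U) j i) := by
    ext z; simp only [hF, hX, hY, key]
  have hFd : Differentiable ℂ F := by
    rw [hFs]
    refine Differentiable.fun_sum fun i _ => Differentiable.fun_sum fun j _ => ?_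
    exact ((fpow_diff _).mul (fpow_diff _)).mul_const _
  have hF0 : F 0 = d := by
    simp only [hF]
    rw [← Matrix.mul_assoc, hX0', trace_mul_comm, hY0, htr]
  have hF' : HasDerivAt F (-(d * Real.log (c * d) : ℝ)) 0 := by
    have h1 : HasDerivAt F (∑ i, ∑ j, (((Real.log (x i) : ℂ) * fpow (x i) 0) * fpow (y j) 0
        + fpow (x i) 0 * ((Real.log (y j) : ℂ) * fpow (y j) 0)) * ((Uᴴ * W) i j * (Wᴴ * Pj * U) j i)) 0 := by
      rw [hFs]
      refine HasDerivAt.fun_sum fun i _ => HasDerivAt.fun_sum fun j _ => ?_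
      exact ((fpow_deriv _).mul (fpow_deriv _)).mul_const _
    convert h1 using 1
    simp only [add_mul, Finset.sum_add_distrib, fl]
    rw [← key, ← key (fun i => fpow (x i) 0), ← hent]
    refine congrArg₂ (· + ·) ?_ ?_
    · have e : dfc W (fun i => fpow (y i) 0) = Y 0 := rfl
      rw [e, ← Matrix.mul_assoc, trace_mul_comm _ (Y 0), ← Matrix.mul_assoc, hY0]
    · have e : dfc U (fun i => fpow (x i) 0) = X 0 := rfl
      rw [e, ← Matrix.mul_assoc, hX0']
  have hb0 : ∀ z : ℂ, z.re = 0 → ‖F z‖ ≤ d := by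
    intro z hz
    have e : F z = trace (((X z)ᴴ * Pj)ᴴ * (Y z * Pj)) := by
      rw [conjTranspose_mul, conjTranspose_conjTranspose, hPj]
      simp only [hF]
      conv_lhs => rw [← hPjPj, Matrix.mul_assoc, trace_mul_comm]
      simp only [Matrix.mul_assoc]
    have e1 : trace (((X z)ᴴ * Pj)ᴴ * ((X z)ᴴ * Pj)) = d := by
      rw [conjTranspose_mul, conjTranspose_conjTranspose, hPj, Matrix.mul_assoc, ← Matrix.mul_assoc (X z), hXX', hz]
      simp only [mul_zero, Complex.ofReal_zero]
      rw [hX0, hPjPj, htr]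
    have e2 : trace ((Y z * Pj)ᴴ * (Y z * Pj)) = d := by
      rw [conjTranspose_mul, hPj, Matrix.mul_assoc, ← Matrix.mul_assoc ((Y z)ᴴ), hYY, hz]
      simp only [mul_zero, Complex.ofReal_zero]
      rw [hY0, hPjPj, htr]
    have := cs_trace _ _ _ _ e1 e2
    rw [← e, ← sq] at this
    exact (pow_le_pow_iff_left₀ (norm_nonneg _) hd.le two_ne_zero).mp this
  have hTT : ∀ z : ℂ, z.re = 1/2 → trace ((X z * Y z)ᴴ * (X z * Y z)) = (c⁻¹ : ℝ) := by
    intro z hz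
    rw [conjTranspose_mul, Matrix.mul_assoc, ← Matrix.mul_assoc ((X z)ᴴ), hXX, trace_mul_comm,
      Matrix.mul_assoc, hYY', hz]
    norm_num
    rw [hX1, hY1, hxy]; simp
  have hb1 : ∀ z : ℂ, z.re = 1/2 → ‖F z‖ ^ 2 ≤ d * c⁻¹ := by
    intro z hz
    have e : F z = trace (Pjᴴ * (X z * Y z)) := by rw [hPj]
    rw [e]
    exact cs_trace _ _ _ _ (by rw [hPj, hPjPj, htr]) (hTT z hz)
  have hcd : 0 < c * d := mul_pos hc hd
  set G : ℂ → ℂ := fun z => Complex.exp (z * (Real.log (c*d) : ℂ)) * F z * (d:ℂ)⁻¹ with hG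
  have hdC : (d:ℂ) ≠ 0 := by exact_mod_cast hd.ne'
  have hGd : Differentiable ℂ G := by
    simp only [hG]
    fun_prop
  have hnG : ∀ z, ‖G z‖ = Real.exp (z.re * Real.log (c*d)) * ‖F z‖ * d⁻¹ := by
    intro z
    simp [hG, Complex.norm_exp, abs_of_pos hd]
  have hexp : Real.exp (1/2 * Real.log (c*d)) = Real.sqrt (c*d) := by
    rw [Real.sqrt_eq_rpow, Real.rpow_def_of_pos hcd, mul_comm]
  have hGb : ∀ z : ℂ, 0 ≤ z.re → z.re ≤ 1/2 → ‖G z‖ ≤ 1 := by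
    intro z hz0 hz1
    refine PhragmenLindelof.vertical_strip (a := 0) (b := 1/2) hGd.diffContOnCl ?_ ?_ ?_ hz0 hz1
    · refine ⟨0, by positivity, 0, ?_⟩
      simp only [zero_mul, Real.exp_zero]
      refine Asymptotics.IsBigO.of_bound (Real.exp |Real.log (c*d)| * (∑ i, ∑ j, Real.exp |Real.log (x i)| * Real.exp |Real.log (y j)| * ‖(Uᴴ * W) i j * (Wᴴ * Pj * U) j i‖) * d⁻¹) ?_
      refine eventually_inf_principal.mpr (Eventually.of_forall fun z hz => ?_)
      have hz0 : 0 ≤ z.re := hz.1.le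
      have hz1 : z.re ≤ 1/2 := hz.2.le
      rw [hnG, norm_one, mul_one]
      gcongr
      · calc z.re * Real.log (c*d) ≤ z.re * |Real.log (c*d)| :=
            mul_le_mul_of_nonneg_left (le_abs_self _) hz0
          _ ≤ 1 * |Real.log (c*d)| := mul_le_mul_of_nonneg_right (by linarith) (abs_nonneg _)
          _ = _ := one_mul _
      · rw [hFs]
        refine (norm_sum_le _ _).trans (Finset.sum_le_sum fun i _ => ?_)
        refine (norm_sum_le _ _).trans (Finset.sum_le_sum fun j _ => ?_)
        rw [norm_mul, norm_mul]
        gcongr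
        · exact fpow_norm_le _ _ hz0 hz1
        · exact fpow_norm_le _ _ hz0 hz1
    · intro z hz
      rw [hnG, hz, zero_mul, Real.exp_zero, one_mul, ← div_eq_mul_inv, div_le_one hd]
      exact hb0 z hz
    · intro z hz
      rw [hnG, hz, hexp, ← div_eq_mul_inv, div_le_one hd]
      have h2 := hb1 z hz
      refine (pow_le_pow_iff_left₀ (by positivity) hd.le two_ne_zero).mp ?_
      rw [mul_pow, Real.sq_sqrt hcd.le]
      calc c * d * ‖F z‖^2 ≤ c * d * (d * c⁻¹) := by gcongr
        _ = d^2 := by field_simp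
  have hG0 : G 0 = 1 := by simp [hG, hF0, hdC]
  have hG1 : deriv G 0 = 0 := by
    have h1 := ((hasDerivAt_id (0:ℂ)).mul_const (Real.log (c*d) : ℂ)).cexp
    have h2 := ((h1.mul hF').mul_const ((d:ℂ)⁻¹)).deriv
    have : deriv G 0 = _ := h2
    rw [this, hF0]
    simp only [id, zero_mul, Complex.exp_zero]
    push_cast
    ring
  have hhalf := hopf_const G hGd hGb hG0 hG1 (1/2)
  have hFh : ((Real.sqrt (c*d) : ℝ) : ℂ) * F (1/2) = d := by
    have e : G (1/2) = ((Real.sqrt (c*d) : ℝ) : ℂ) * F (1/2) * (d:ℂ)⁻¹ := by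
      simp only [hG]
      rw [← hexp]; push_cast; rfl
    rw [e] at hhalf
    field_simp at hhalf
    exact hhalf
  set l : ℝ := Real.sqrt (c*d) with hl
  have hl2 : l * l = c * d := Real.mul_self_sqrt hcd.le
  have hz : Pj - (l:ℂ) • (X (1/2) * Y (1/2)) = 0 := by
    apply eq_zero_of_trace
    set T := X (1/2) * Y (1/2) with hT
    have t1 : trace (Tᴴ * T) = (c⁻¹ : ℝ) := hTT (1/2) (by norm_num)
    have t2 : (l:ℂ) * trace (Pj * T) = d := hFh
    have t3 : (l:ℂ) * trace (Tᴴ * Pj) = d := by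
      have e : Tᴴ * Pj = (Pj * T)ᴴ := by rw [conjTranspose_mul Pj T, hPj]
      rw [e, trace_conjTranspose]
      have := congrArg star t2
      simpa using this
    rw [conjTranspose_sub, conjTranspose_smul, hPj]
    simp only [sub_mul, mul_sub, Matrix.smul_mul, Matrix.mul_smul, trace_sub, trace_smul, smul_eq_mul,
      hPjPj, htr]
    have hs : star (l:ℂ) = l := by simp
    rw [hs, t1, t2, t3]
    rw [show (d:ℂ) - d - (d - l * (l * ((c⁻¹:ℝ):ℂ))) = (l*l : ℝ) * ((c⁻¹:ℝ):ℂ) - d by push_cast; ring, hl2]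
    push_cast
    have : (c:ℂ) ≠ 0 := by exact_mod_cast hc.ne'
    field_simp; ring
  exact sub_eq_zero.mp hz

theorem core' (Pj U W : Matrix n n ℂ) (hPj : Pjᴴ = Pj) (hPjPj : Pj * Pj = Pj)
    (c d : ℝ) (hc : 0 < c) (hd : 0 < d) (htr : trace Pj = d)
    (hU : Uᴴ * U = 1) (hW : Wᴴ * W = 1)
    (x y : n → ℝ) (hx : ∀ i, 0 ≤ x i) (hy : ∀ i, 0 ≤ y i)
    (hxs : trace (Pj * dfc U (fun i => fpow (x i) 0)) = d)
    (hys : trace (Pj * dfc W (fun i => fpow (y i) 0)) = d)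
    (hxy : trace (dfc U (fun i => (x i : ℂ)) * dfc W (fun i => (y i : ℂ))) = (c⁻¹ : ℝ))
    (hent : trace (Pj * dfc U (fun i => (Real.log (x i) : ℂ)))
      + trace (Pj * dfc W (fun i => (Real.log (y i) : ℂ))) = -(d * Real.log (c * d) : ℝ)) :
    Pj = ((c*d : ℝ) : ℂ) • (dfc U (fun i => (x i : ℂ)) * dfc W (fun i => (y i : ℂ))) ∧
    Pj = ((c*d : ℝ) : ℂ) • (dfc W (fun i => (y i : ℂ)) * dfc U (fun i => (x i : ℂ))) := by
  have h := core Pj U W hPj hPjPj c d hc hd htr hU hW x y hx hy hxs hys hxy hent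
  have fs : ∀ t : ℝ, star (fpow t (1/2)) = fpow t (1/2) := by
    intro t; unfold fpow; split_ifs
    · simp
    · simp only [Complex.star_def, ← Complex.exp_conj]
      congr 1
      simp [map_ofNat]
  have ff : ∀ t : ℝ, 0 ≤ t → fpow t (1/2) * fpow t (1/2) = t := by
    intro t ht
    have := fpow_star_mul t (1/2)
    rw [fs] at this
    rw [this]; norm_num; rw [fpow_one t ht]
  set P := dfc U (fun i => fpow (x i) (1/2)) with hP
  set Q := dfc W (fun i => fpow (y i) (1/2)) with hQ
  have hPP : P * P = dfc U (fun i => (x i : ℂ)) := by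
    simp only [hP, dfc_mul hU, ff _ (hx _)]
  have hQQ : Q * Q = dfc W (fun i => (y i : ℂ)) := by
    simp only [hQ, dfc_mul hW, ff _ (hy _)]
  have hPs : Pᴴ = P := by simp only [hP, dfc_conj, fs]
  have hQs : Qᴴ = Q := by simp only [hQ, dfc_conj, fs]
  have h' : Pj = ((Real.sqrt (c*d) : ℝ) : ℂ) • (Q * P) := by
    have := congrArg conjTranspose h
    rw [hPj, conjTranspose_smul, conjTranspose_mul, hPs, hQs] at this
    simpa using this
  have hl2 : Real.sqrt (c*d) * Real.sqrt (c*d) = c * d := Real.mul_self_sqrt (by positivity)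
  have hl0 : ((Real.sqrt (c*d) : ℝ) : ℂ) ≠ 0 := by
    have : Real.sqrt (c*d) ≠ 0 := by positivity
    exact_mod_cast this
  have hcomm : P * Q = Q * P := by
    have := h.symm.trans h'
    exact smul_right_injective _ hl0 this
  rw [← hPP, ← hQQ]
  constructor
  · calc Pj = Pj * Pj := hPjPj.symm
      _ = (((Real.sqrt (c*d) : ℝ) : ℂ) • (P * Q)) * (((Real.sqrt (c*d) : ℝ) : ℂ) • (Q * P)) := by
        rw [← h, ← h']
      _ = _ := by
        rw [smul_mul_smul_comm, ← Complex.ofReal_mul, hl2]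
        congr 1
        calc P * Q * (Q * P) = P * (Q * (Q * P)) := by simp only [Matrix.mul_assoc]
          _ = P * P * (Q * Q) := by rw [← hcomm, ← Matrix.mul_assoc Q, ← hcomm]; simp only [Matrix.mul_assoc]
  · calc Pj = Pj * Pj := hPjPj.symm
      _ = (((Real.sqrt (c*d) : ℝ) : ℂ) • (Q * P)) * (((Real.sqrt (c*d) : ℝ) : ℂ) • (P * Q)) := by
        rw [← h, ← h']
      _ = _ := by
        rw [smul_mul_smul_comm, ← Complex.ofReal_mul, hl2]
        congr 1
        calc Q * P * (P * Q) = Q * (P * (P * Q)) := by simp only [Matrix.mul_assoc]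
          _ = Q * Q * (P * P) := by rw [hcomm, ← Matrix.mul_assoc P, hcomm]; simp only [Matrix.mul_assoc]

end core


section factor
variable {m : Type*} [Fintype m] [DecidableEq m]

lemma herm_dfc {M : Matrix m m ℂ} (h : M.IsHermitian) :
    M = dfc (h.eigenvectorUnitary : Matrix m m ℂ) (fun i => (h.eigenvalues i : ℂ)) := by
  have := h.spectral_theorem
  rw [Unitary.conjStarAlgAut_apply] at this
  exact this

lemma eigU_left {M : Matrix m m ℂ} (h : M.IsHermitian) :
    (h.eigenvectorUnitary : Matrix m m ℂ)ᴴ * (h.eigenvectorUnitary : Matrix m m ℂ) = 1 :=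
  Unitary.coe_star_mul_self h.eigenvectorUnitary

lemma eigU_right {M : Matrix m m ℂ} (h : M.IsHermitian) :
    (h.eigenvectorUnitary : Matrix m m ℂ) * (h.eigenvectorUnitary : Matrix m m ℂ)ᴴ = 1 :=
  Unitary.coe_mul_star_self h.eigenvectorUnitary

lemma dfc_inner {U : Matrix m m ℂ} (hU : Uᴴ * U = 1) (u : m → ℂ) :
    Uᴴ * dfc U u * U = diagonal u := by
  unfold dfc
  calc _ = (Uᴴ * U) * diagonal u * (Uᴴ * U) := by simp only [Matrix.mul_assoc]
    _ = _ := by rw [hU, Matrix.one_mul, Matrix.mul_one]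

lemma commute_dfc {U : Matrix m m ℂ} (hU : Uᴴ * U = 1) (hU' : U * Uᴴ = 1) (u : m → ℝ)
    (f : ℝ → ℂ) (s : Matrix m m ℂ) (h : s * dfc U (fun i => (u i : ℂ)) = dfc U (fun i => (u i : ℂ)) * s) :
    s * dfc U (fun i => f (u i)) = dfc U (fun i => f (u i)) * s := by
  have e1 : ∀ w : m → ℂ, Uᴴ * (s * dfc U w) * U = (Uᴴ * s * U) * diagonal w := by
    intro w
    rw [← dfc_inner hU w]
    calc _ = Uᴴ * s * 1 * dfc U w * U := by simp only [Matrix.mul_assoc, Matrix.mul_one, Matrix.one_mul]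
      _ = _ := by rw [← hU']; simp only [Matrix.mul_assoc]
  have e2 : ∀ w : m → ℂ, Uᴴ * (dfc U w * s) * U = diagonal w * (Uᴴ * s * U) := by
    intro w
    rw [← dfc_inner hU w]
    calc _ = Uᴴ * dfc U w * 1 * s * U := by simp only [Matrix.mul_assoc, Matrix.mul_one, Matrix.one_mul]
      _ = _ := by rw [← hU']; simp only [Matrix.mul_assoc]
  have inj : ∀ P Q : Matrix m m ℂ, Uᴴ * P * U = Uᴴ * Q * U → P = Q := by
    intro P Q hPQ
    have := congrArg (fun T => U * T * Uᴴ) hPQ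
    calc P = (U * Uᴴ) * P * (U * Uᴴ) := by rw [hU', Matrix.one_mul, Matrix.mul_one]
      _ = (U * Uᴴ) * Q * (U * Uᴴ) := by simpa only [Matrix.mul_assoc] using this
      _ = Q := by rw [hU', Matrix.one_mul, Matrix.mul_one]
  apply inj
  rw [e1, e2]
  have h2 : (Uᴴ * s * U) * diagonal (fun i => (u i : ℂ)) = diagonal (fun i => (u i : ℂ)) * (Uᴴ * s * U) := by
    rw [← e1, ← e2, h]
  ext i j
  have h3 := congrFun (congrFun h2 i) j
  rw [mul_diagonal, diagonal_mul] at h3 ⊢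
  by_cases hij : u i = u j
  · rw [hij, mul_comm]
  · have : (Uᴴ * s * U) i j = 0 := by
      have h4 : ((u j : ℂ) - u i) * (Uᴴ * s * U) i j = 0 := by linear_combination h3
      rcases mul_eq_zero.mp h4 with h5 | h5
      · exact absurd (by exact_mod_cast (sub_eq_zero.mp h5).symm) hij
      · exact h5
    rw [this]; ring

lemma proj_factor {P : Matrix m m ℂ} (hP : Pᴴ = P) (hPP : P * P = P) :
    ∃ (q : ℕ) (F : Matrix m (Fin q) ℂ), Fᴴ * F = 1 ∧ F * Fᴴ = P := by
  have h : P.IsHermitian := hP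
  set U := (h.eigenvectorUnitary : Matrix m m ℂ)
  set u := h.eigenvalues
  have hU : Uᴴ * U = 1 := eigU_left h
  have hd : P = dfc U (fun i => (u i : ℂ)) := herm_dfc h
  have hu : ∀ i, u i = 0 ∨ u i = 1 := by
    intro i
    have h1 := hPP
    rw [hd, dfc_mul hU] at h1
    have h2 := congrArg (fun T => Uᴴ * T * U) h1
    simp only [dfc_inner hU] at h2
    have h3 := congrFun (congrFun h2 i) i
    simp only [diagonal_apply_eq] at h3
    have h4 : u i * u i = u i := by exact_mod_cast h3
    rcases eq_or_ne (u i) 0 with h5 | h5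
    · exact Or.inl h5
    · exact Or.inr (mul_left_cancel₀ h5 (by rw [h4, mul_one]))
  let S := {i : m // u i = 1}
  let eq := Fintype.equivFin S
  refine ⟨Fintype.card S, U.submatrix id (fun k => (eq.symm k : m)), ?_, ?_⟩
  · ext k l
    have := congrFun (congrFun hU (eq.symm k : m)) (eq.symm l : m)
    simp only [mul_apply, conjTranspose_apply, submatrix_apply, id] at this ⊢
    rw [this, one_apply, one_apply]
    congr 1
    simp [Subtype.coe_inj]
  · rw [hd]
    ext i j
    have e1 : (dfc U fun i => (u i : ℂ)) i j = ∑ t, U i t * (u t : ℂ) * star (U j t) := by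
      rw [dfc, mul_apply]
      simp only [mul_diagonal, conjTranspose_apply]
    rw [e1, mul_apply]
    simp only [conjTranspose_apply, submatrix_apply, id]
    rw [Equiv.sum_comp eq.symm (fun t : S => U i t * star (U j t))]
    rw [← Finset.sum_subtype (Finset.univ.filter fun t => u t = 1) (by simp)
      (fun t => U i t * star (U j t)), Finset.sum_filter]
    refine Finset.sum_congr rfl fun t _ => ?_
    rcases hu t with h | h <;> simp [h]



lemma proj_trace {P : Matrix m m ℂ} (hP : Pᴴ = P) (hPP : P * P = P) :
    ∃ q : ℕ, trace P = q := by
  obtain ⟨q, F, h1, h2⟩ := proj_factor hP hPP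
  refine ⟨q, ?_⟩
  rw [← h2, trace_mul_comm, h1]; simp

lemma proj_trace_zero {P : Matrix m m ℂ} (hP : Pᴴ = P) (hPP : P * P = P) (h : trace P = 0) :
    P = 0 := eq_zero_of_trace P (by rw [hP, hPP, h])

lemma minproj {J : Type*} (y : J → Matrix m m ℂ) (hy : ∀ j, ∃ j', (y j)ᴴ = y j') [Nonempty m] :
    ∃ e : Matrix m m ℂ, (∀ j, e * y j = y j * e) ∧ eᴴ = e ∧ e * e = e ∧ e ≠ 0 ∧
      ∀ x : Matrix m m ℂ, (∀ j, x * y j = y j * x) → ∃ l : ℂ, e * x * e = l • e := by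
  let S : ℕ → Prop := fun q => ∃ e : Matrix m m ℂ, (∀ j, e * y j = y j * e) ∧ eᴴ = e ∧ e * e = e ∧
    e ≠ 0 ∧ trace e = q
  have hS : ∃ q, S q := by
    obtain ⟨q, hq⟩ := proj_trace (P := (1 : Matrix m m ℂ)) (by simp) (by simp)
    exact ⟨q, 1, by simp, by simp, by simp, one_ne_zero, hq⟩
  obtain ⟨e, he1, he2, he3, he4, he5⟩ := Nat.find_spec hS
  have hmin : ∀ q, S q → Nat.find hS ≤ q := fun q hq => Nat.find_min' hS hq
  have hstar : ∀ x : Matrix m m ℂ, (∀ j, x * y j = y j * x) → ∀ j, xᴴ * y j = y j * xᴴ := by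
    intro x hx j
    obtain ⟨j', hj'⟩ := hy j
    have := congrArg conjTranspose (hx j')
    rw [conjTranspose_mul, conjTranspose_mul, ← hj', conjTranspose_conjTranspose] at this
    exact this.symm
  have hherm : ∀ h : Matrix m m ℂ, (∀ j, h * y j = y j * h) → hᴴ = h → e * h = h → h * e = h →
      ∃ l : ℂ, h = l • e := by
    intro h hN hh heh hhe
    have hH : h.IsHermitian := hh
    set U := (hH.eigenvectorUnitary : Matrix m m ℂ)
    set u := hH.eigenvalues
    have hU : Uᴴ * U = 1 := eigU_left hH
    have hU' : U * Uᴴ = 1 := eigU_right hH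
    have hd : h = dfc U (fun i => (u i : ℂ)) := herm_dfc hH
    by_cases hz : ∀ i, u i = 0
    · refine ⟨0, ?_⟩
      rw [hd]; simp [hz, dfc]
    · push Not at hz
      obtain ⟨i, hi⟩ := hz
      let g : ℝ → ℂ := fun t => if t = u i then 1 else 0
      set f := dfc U (fun k => g (u k)) with hf
      have fN : ∀ j, f * y j = y j * f := by
        intro j
        refine (commute_dfc hU hU' u g (y j) ?_).symm
        rw [← hd]; exact (hN j).symm
      have fs : fᴴ = f := by
        rw [hf, dfc_conj]; congr 1; ext k; simp only [g]; split_ifs <;> simp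
      have ff : f * f = f := by
        rw [hf, dfc_mul hU]; congr 1; ext k; simp only [g]; split_ifs <;> simp
      have hfm : h * f = (u i : ℂ) • f := by
        rw [hf, hd, dfc_mul hU]
        have : (fun k => (u k : ℂ) * g (u k)) = fun k => (u i : ℂ) * g (u k) := by
          ext k; simp only [g]; split_ifs with hk <;> simp [hk]
        rw [this]
        unfold dfc
        have : (diagonal fun k => (u i : ℂ) * g (u k)) = (u i : ℂ) • diagonal (fun k => g (u k)) := by
          rw [← diagonal_smul]; rfl
        rw [this]; simp
      have hui : (u i : ℂ) ≠ 0 := by exact_mod_cast hi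
      have hef : e * f = f := by
        have : (u i : ℂ) • (e * f) = (u i : ℂ) • f := by
          rw [← Matrix.mul_smul, ← hfm, ← Matrix.mul_assoc, heh]
        exact smul_right_injective _ hui this
      have hfe : f * e = f := by
        have := congrArg conjTranspose hef
        rwa [conjTranspose_mul, fs, he2] at this
      have f0 : f ≠ 0 := by
        intro h0
        have h1 := dfc_inner hU (fun k => g (u k))
        rw [← hf, h0] at h1
        have := congrFun (congrFun h1 i) i
        simp [g] at this
      obtain ⟨q1, hq1⟩ := proj_trace fs ff
      have gs : (e - f)ᴴ = e - f := by rw [conjTranspose_sub, he2, fs]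
      have gg : (e - f) * (e - f) = e - f := by
        rw [sub_mul, mul_sub, mul_sub, he3, hef, hfe, ff]; abel
      obtain ⟨q2, hq2⟩ := proj_trace gs gg
      have h3 := hmin q1 ⟨f, fN, fs, ff, f0, hq1⟩
      have h4 : (q2 : ℂ) = (Nat.find hS : ℂ) - q1 := by
        rw [← hq2, trace_sub, he5, hq1]
      have h5 : q2 + q1 = Nat.find hS := by
        have : (q2 : ℂ) + q1 = (Nat.find hS : ℂ) := by rw [h4]; ring
        exact_mod_cast this
      have h6 : q2 = 0 := by omega
      have h7 : e - f = 0 := proj_trace_zero gs gg (by rw [hq2, h6]; simp)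
      have h8 : e = f := sub_eq_zero.mp h7
      refine ⟨u i, ?_⟩
      rw [h8, ← hfm, ← h8, hhe]
  refine ⟨e, he1, he2, he3, he4, ?_⟩
  intro x hx
  set t := e * x * e with ht
  have htN : ∀ j, t * y j = y j * t := by
    intro j
    rw [ht, Matrix.mul_assoc, he1, ← Matrix.mul_assoc, Matrix.mul_assoc e, hx, ← Matrix.mul_assoc e, he1]
    simp only [Matrix.mul_assoc]
  have htsN := hstar t htN
  have het : e * t = t := by rw [ht, ← Matrix.mul_assoc, ← Matrix.mul_assoc, he3]
  have hte : t * e = t := by rw [ht, Matrix.mul_assoc, he3]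
  have hets : e * tᴴ = tᴴ := by
    have := congrArg conjTranspose hte; rwa [conjTranspose_mul, he2] at this
  have htse : tᴴ * e = tᴴ := by
    have := congrArg conjTranspose het; rwa [conjTranspose_mul, he2] at this
  obtain ⟨l1, h1⟩ := hherm (t + tᴴ) (fun j => by rw [add_mul, mul_add, htN, htsN])
    (by rw [conjTranspose_add, conjTranspose_conjTranspose, add_comm])
    (by rw [mul_add, het, hets]) (by rw [add_mul, hte, htse])
  obtain ⟨l2, h2⟩ := hherm (Complex.I • (t - tᴴ))
    (fun j => by rw [Matrix.smul_mul, Matrix.mul_smul, sub_mul, mul_sub, htN, htsN])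
    (by rw [conjTranspose_smul, conjTranspose_sub, conjTranspose_conjTranspose]
        simp only [Complex.star_def, Complex.conj_I, neg_smul, ← smul_neg, neg_sub])
    (by rw [Matrix.mul_smul, mul_sub, het, hets]) (by rw [Matrix.smul_mul, sub_mul, hte, htse])
  refine ⟨(1/2) * l1 - (Complex.I/2) * l2, ?_⟩
  rw [sub_smul, mul_smul, mul_smul, ← h1, ← h2, smul_smul]
  have : Complex.I / 2 * Complex.I = -(1/2) := by
    rw [div_mul_eq_mul_div, Complex.I_mul_I]; norm_num
  rw [this]
  module

end factor


section factor2
variable {m : Type*} [Fintype m] [DecidableEq m]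

lemma orth_fam {J : Type*} (y : J → Matrix m m ℂ) (ξ : m → ℂ) :
    ∃ (p : ℕ) (v : Fin p → Matrix m m ℂ), (∀ i j, v i * y j = y j * v i) ∧
      (∀ i j, star (v i *ᵥ ξ) ⬝ᵥ (v j *ᵥ ξ) = if i = j then 1 else 0) ∧
      ∀ x : Matrix m m ℂ, (∀ j, x * y j = y j * x) →
        ∃ c : Fin p → ℂ, x *ᵥ ξ = ∑ i, c i • (v i *ᵥ ξ) := by
  let L : Submodule ℂ (EuclideanSpace ℂ m) :=
    { carrier := {w | ∃ x : Matrix m m ℂ, (∀ j, x * y j = y j * x) ∧ w = WithLp.toLp 2 (x *ᵥ ξ)}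
      add_mem' := by
        rintro _ _ ⟨x, hx, rfl⟩ ⟨x', hx', rfl⟩
        refine ⟨x + x', fun j => by rw [add_mul, mul_add, hx, hx'], ?_⟩
        rw [add_mulVec, WithLp.toLp_add]
      zero_mem' := ⟨0, by simp, by simp⟩
      smul_mem' := by
        rintro l _ ⟨x, hx, rfl⟩
        refine ⟨l • x, fun j => by rw [smul_mul_assoc, mul_smul_comm, hx], ?_⟩
        rw [smul_mulVec, WithLp.toLp_smul] }
  let bb := stdOrthonormalBasis ℂ L
  have h1 : ∀ i, ∃ x : Matrix m m ℂ, (∀ j, x * y j = y j * x) ∧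
    ((bb i : L) : EuclideanSpace ℂ m) = WithLp.toLp 2 (x *ᵥ ξ) := fun i => (bb i).2
  choose v hv hb using h1
  refine ⟨_, v, hv, ?_, ?_⟩
  · intro i j
    have := orthonormal_iff_ite.mp bb.orthonormal i j
    rw [Submodule.coe_inner, hb, hb, EuclideanSpace.inner_eq_star_dotProduct] at this
    rw [← this, dotProduct_comm]
  · intro x hx
    let w : L := ⟨WithLp.toLp 2 (x *ᵥ ξ), x, hx, rfl⟩
    refine ⟨fun i => bb.repr w i, ?_⟩
    have := congrArg (fun t : L => WithLp.ofLp (t : EuclideanSpace ℂ m)) (bb.sum_repr w)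
    simp only [Submodule.coe_sum, Submodule.coe_smul, hb, WithLp.ofLp_sum, WithLp.ofLp_smul] at this
    exact this.symm

lemma factor_lemma [Nonempty m] {I J : Type*} (x : I → Matrix m m ℂ) (y : J → Matrix m m ℂ)
    (hx : ∀ i, ∃ i', (x i)ᴴ = x i') (hy : ∀ j, ∃ j', (y j)ᴴ = y j')
    (hxy : ∀ i j, x i * y j = y j * x i)
    (hirr : ∀ z : Matrix m m ℂ, (∀ i, z * x i = x i * z) → (∀ j, z * y j = y j * z) →
      ∃ l : ℂ, z = l • 1) :
    ∃ (p r : ℕ) (W : Matrix m (Fin p × Fin r) ℂ), Wᴴ * W = 1 ∧ W * Wᴴ = 1 ∧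
      ∃ (x' : I → Matrix (Fin p) (Fin p) ℂ) (y' : J → Matrix (Fin r) (Fin r) ℂ),
        (∀ i, x i = W * (x' i ⊗ₖ (1 : Matrix (Fin r) (Fin r) ℂ)) * Wᴴ) ∧
        ∀ j, y j = W * ((1 : Matrix (Fin p) (Fin p) ℂ) ⊗ₖ y' j) * Wᴴ := by
  obtain ⟨e, hey, heH, hee, he0, hmin⟩ := minproj y hy
  obtain ⟨r, X, hX1, hX2⟩ := proj_factor heH hee
  have hr : 0 < r := by
    rcases Nat.eq_zero_or_pos r with h | h
    · subst h
      exact absurd (by rw [← hX2]; ext i j; simp [mul_apply]) he0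
    · exact h
  have heX : e * X = X := by rw [← hX2, Matrix.mul_assoc, hX1, Matrix.mul_one]
  set k0 : Fin r := ⟨0, hr⟩
  set ξ : m → ℂ := X.col k0 with hξ
  have heξ : e *ᵥ ξ = ξ := by
    have := congrArg (fun T : Matrix m (Fin r) ℂ => T.col k0) heX
    ext i
    exact congrFun this i
  have hξξ : star ξ ⬝ᵥ ξ = 1 := by
    have := congrFun (congrFun hX1 k0) k0
    simpa [mul_apply, dotProduct, hξ] using this
  obtain ⟨p, v', hv'y, hv'o, hv's⟩ := orth_fam y ξ
  -- commutant closed under star and products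
  have star_y : ∀ z : Matrix m m ℂ, (∀ j, z * y j = y j * z) → ∀ j, zᴴ * y j = y j * zᴴ := by
    intro z hz j
    obtain ⟨j', hj'⟩ := hy j
    have := congrArg conjTranspose (hz j')
    rw [conjTranspose_mul, conjTranspose_mul, ← hj', conjTranspose_conjTranspose] at this
    exact this.symm
  have mul_y : ∀ z w : Matrix m m ℂ, (∀ j, z * y j = y j * z) → (∀ j, w * y j = y j * w) →
      ∀ j, (z * w) * y j = y j * (z * w) := by
    intro z w hz hw j
    rw [Matrix.mul_assoc, hw, ← Matrix.mul_assoc, hz, Matrix.mul_assoc]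
  -- scalars
  have scal : ∀ a b : Matrix m m ℂ, (∀ j, a * y j = y j * a) → (∀ j, b * y j = y j * b) →
      e * (aᴴ * b) * e = (star (a *ᵥ ξ) ⬝ᵥ (b *ᵥ ξ)) • e := by
    intro a b ha hb
    obtain ⟨l, hl⟩ := hmin (aᴴ * b) (mul_y _ _ (star_y a ha) hb)
    have h1 : star ξ ⬝ᵥ ((e * (aᴴ * b) * e) *ᵥ ξ) = l := by
      rw [hl, smul_mulVec, heξ, dotProduct_smul, hξξ, smul_eq_mul, mul_one]
    have h2 : star ξ ⬝ᵥ ((e * (aᴴ * b) * e) *ᵥ ξ) = star (a *ᵥ ξ) ⬝ᵥ (b *ᵥ ξ) := by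
      rw [← mulVec_mulVec, heξ, ← mulVec_mulVec, ← mulVec_mulVec, dotProduct_mulVec,
        ← heH, ← star_mulVec, heξ, dotProduct_mulVec, ← star_mulVec]
    rw [hl, ← h1, h2]
  set v : Fin p → Matrix m m ℂ := fun i => v' i * e with hv
  have hvy : ∀ i j, v i * y j = y j * v i := fun i => mul_y _ _ (hv'y i) hey
  have hvξ : ∀ i, v i *ᵥ ξ = v' i *ᵥ ξ := fun i => by rw [hv, ← mulVec_mulVec, heξ]
  have hve : ∀ i, v i * e = v i := fun i => by rw [hv, Matrix.mul_assoc, hee]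
  have hvv : ∀ i j, (v i)ᴴ * v j = if i = j then e else 0 := by
    intro i j
    have h1 : (v i)ᴴ * v j = e * ((v' i)ᴴ * v' j) * e := by
      simp only [hv, conjTranspose_mul, heH, Matrix.mul_assoc]
    rw [h1, scal _ _ (hv'y i) (hv'y j), hv'o]
    split_ifs <;> simp
  have span : ∀ z : Matrix m m ℂ, (∀ j, z * y j = y j * z) → ∃ c : Fin p → ℂ,
      z * e = ∑ i, c i • v i := by
    intro z hz
    obtain ⟨c, hc⟩ := hv's z hz
    refine ⟨c, ?_⟩
    set t := z * e - ∑ i, c i • v i with ht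
    have hty : ∀ j, t * y j = y j * t := by
      intro j
      rw [ht, sub_mul, mul_sub, mul_y z e hz hey, Finset.sum_mul, Finset.mul_sum]
      simp only [smul_mul_assoc, mul_smul_comm, hvy]
    have htξ : t *ᵥ ξ = 0 := by
      rw [ht, sub_mulVec, ← mulVec_mulVec, heξ, hc, sum_mulVec]
      simp only [smul_mulVec, hvξ, sub_self]
    have hte : t * e = t := by
      rw [ht, sub_mul, Matrix.mul_assoc, hee, Finset.sum_mul]
      simp only [smul_mul_assoc, hve]
    have h0 := scal t t hty hty
    rw [htξ, dotProduct_zero, zero_smul] at h0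
    have h1 : (t)ᴴ * t = 0 := by
      rw [← h0]
      nth_rewrite 1 [← hte]
      nth_rewrite 2 [← hte]
      simp only [conjTranspose_mul, heH, Matrix.mul_assoc]
    have h2 : t = 0 := eq_zero_of_trace t (by rw [h1, trace_zero])
    exact sub_eq_zero.mp h2
  let W : Matrix m (Fin p × Fin r) ℂ := fun g ik => (v ik.1 * X) g ik.2
  have hWW : Wᴴ * W = 1 := by
    ext ⟨i, k⟩ ⟨j, l⟩
    have h1 : ((v i * X)ᴴ * (v j * X)) = if i = j then 1 else 0 := by
      rw [conjTranspose_mul, Matrix.mul_assoc, ← Matrix.mul_assoc (v i)ᴴ, hvv]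
      split_ifs
      · rw [heX, hX1]
      · simp
    have h2 := congrFun (congrFun h1 k) l
    rw [mul_apply] at h2 ⊢
    refine h2.trans ?_
    rw [one_apply]
    split_ifs <;> simp_all [one_apply]
  have hyW : ∀ j, y j * W = W * ((1 : Matrix (Fin p) (Fin p) ℂ) ⊗ₖ (Xᴴ * y j * X)) := by
    intro j
    ext g ⟨i, k⟩
    have h1 : y j * (v i * X) = (v i * X) * (Xᴴ * y j * X) := by
      have : (v i * X) * (Xᴴ * y j * X) = v i * ((X * Xᴴ) * (y j * X)) := by
        simp only [Matrix.mul_assoc]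
      rw [this, hX2, ← Matrix.mul_assoc (v i) e, hve, ← Matrix.mul_assoc (y j),
        ← Matrix.mul_assoc (v i), hvy]
    have h2 := congrFun (congrFun h1 g) k
    rw [mul_apply, mul_apply] at h2
    rw [mul_apply, mul_apply, Fintype.sum_prod_type, Finset.sum_eq_single i]
    · simpa [W, kroneckerMap_apply] using h2
    · intro b _ hb
      simp [kroneckerMap_apply, one_apply, hb]
    · simp
  have hxW : ∀ z : Matrix m m ℂ, (∀ j, z * y j = y j * z) → ∃ c : Matrix (Fin p) (Fin p) ℂ,
      z * W = W * (c ⊗ₖ (1 : Matrix (Fin r) (Fin r) ℂ)) := by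
    intro z hz
    have h1 : ∀ i, ∃ c : Fin p → ℂ, z * v i = ∑ j, c j • v j := by
      intro i
      obtain ⟨c, hc⟩ := span (z * v i) (mul_y _ _ hz (hvy i))
      exact ⟨c, by rw [← hc, Matrix.mul_assoc, hve]⟩
    choose c hc using h1
    refine ⟨Matrix.of fun j i => c i j, ?_⟩
    ext g ⟨i, k⟩
    have h1 : z * (v i * X) = ∑ j, c i j • (v j * X) := by
      rw [← Matrix.mul_assoc, hc, Matrix.sum_mul]
      simp only [Matrix.smul_mul]
    have h2 := congrFun (congrFun h1 g) k
    rw [mul_apply, Matrix.sum_apply] at h2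
    rw [mul_apply, mul_apply, Fintype.sum_prod_type]
    refine h2.trans (Finset.sum_congr rfl fun j _ => ?_)
    rw [Finset.sum_eq_single k]
    · rw [Matrix.smul_apply, smul_eq_mul, mul_comm]
      simp [W, kroneckerMap_apply]
    · intro b _ hb
      simp [kroneckerMap_apply, one_apply, hb]
    · simp
  have hxc : ∀ i, ∀ j, x i * y j = y j * x i := hxy
  choose x' hx' using fun i => hxW (x i) (hxc i)
  -- W W* = 1
  have comm : ∀ (z : Matrix m m ℂ) (a b : Matrix (Fin p × Fin r) (Fin p × Fin r) ℂ),
      z * W = W * a → zᴴ * W = W * b → (W * Wᴴ) * z = z * (W * Wᴴ) := by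
    intro z a b h1 h2
    have h3 : Wᴴ * z = bᴴ * Wᴴ := by
      have := congrArg conjTranspose h2
      simpa [conjTranspose_mul] using this
    have h4 : bᴴ = a := by
      have : Wᴴ * z * W = bᴴ := by rw [h3, Matrix.mul_assoc, hWW, Matrix.mul_one]
      rw [← this, Matrix.mul_assoc, h1, ← Matrix.mul_assoc, hWW, Matrix.one_mul]
    rw [Matrix.mul_assoc, h3, h4, ← Matrix.mul_assoc, ← h1, Matrix.mul_assoc]
  obtain ⟨l, hl⟩ := hirr (W * Wᴴ) (fun i => by
      obtain ⟨i', hi'⟩ := hx i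
      exact comm _ _ _ (hx' i) (by rw [hi', hx' i'])) (fun j => by
      obtain ⟨j', hj'⟩ := hy j
      exact comm _ _ _ (hyW j) (by rw [hj', hyW j']))
  have hp : Nonempty (Fin p) := by
    by_contra hne
    rw [not_nonempty_iff] at hne
    obtain ⟨c, hc⟩ := span 1 (by simp)
    rw [Matrix.one_mul, Finset.univ_eq_empty, Finset.sum_empty] at hc
    exact he0 hc
  obtain ⟨i0⟩ := hp
  have hW1 : W * Wᴴ = 1 := by
    have h1 : Wᴴ * (W * Wᴴ) * W = 1 := by
      rw [← Matrix.mul_assoc, hWW, Matrix.one_mul, hWW]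
    rw [hl, Matrix.mul_smul, Matrix.mul_one, Matrix.smul_mul, hWW] at h1
    have h2 := congrFun (congrFun h1 (i0, k0)) (i0, k0)
    simp at h2
    rw [hl, h2, one_smul]
  refine ⟨p, r, W, hWW, hW1, x', fun j => Xᴴ * y j * X, fun i => ?_, fun j => ?_⟩
  · rw [← hx', Matrix.mul_assoc, hW1, Matrix.mul_one]
  · rw [← hyW, Matrix.mul_assoc, hW1, Matrix.mul_one]

end factor2


section emb
variable {n m k : Type*} [Fintype n] [DecidableEq n] [Fintype m] [DecidableEq m]
  [Fintype k] [DecidableEq k]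

/-- embedding of an operator on a tensor factor -/
def emb (f : n ≃ m × k) (M : Matrix m m ℂ) : Matrix n n ℂ :=
  (M ⊗ₖ (1 : Matrix k k ℂ)).submatrix f f

/-- partial trace -/
def ptr (f : n ≃ m × k) (P : Matrix n n ℂ) : Matrix m m ℂ :=
  Matrix.of fun i j => ∑ t, P (f.symm (i, t)) (f.symm (j, t))

lemma emb_mul (f : n ≃ m × k) (M N : Matrix m m ℂ) : emb f (M * N) = emb f M * emb f N := by
  rw [emb, emb, emb, submatrix_mul_equiv, ← mul_kronecker_mul, Matrix.one_mul]

lemma emb_one (f : n ≃ m × k) : emb f (1 : Matrix m m ℂ) = 1 := by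
  rw [emb, one_kronecker_one, submatrix_one_equiv]

lemma emb_conj (f : n ≃ m × k) (M : Matrix m m ℂ) : emb f Mᴴ = (emb f M)ᴴ := by
  rw [emb, emb, conjTranspose_submatrix, conjTranspose_kronecker, conjTranspose_one]

lemma emb_diag (f : n ≃ m × k) (u : m → ℂ) :
    emb f (diagonal u) = diagonal (fun i => u (f i).1) := by
  ext i j
  by_cases h : i = j
  · subst h; simp [emb]
  · have : f i ≠ f j := fun h' => h (f.injective h')
    rw [diagonal_apply_ne _ h, emb, submatrix_apply, kroneckerMap_apply]
    by_cases h1 : (f i).1 = (f j).1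
    · have h2 : (f i).2 ≠ (f j).2 := fun h2 => this (Prod.ext h1 h2)
      rw [one_apply_ne h2, mul_zero]
    · rw [diagonal_apply_ne _ h1, zero_mul]

lemma emb_dfc (f : n ≃ m × k) (U : Matrix m m ℂ) (u : m → ℂ) :
    emb f (dfc U u) = dfc (emb f U) (fun i => u (f i).1) := by
  rw [dfc, emb_mul, emb_mul, emb_diag, emb_conj, dfc]

lemma trace_emb (f : n ≃ m × k) (P : Matrix n n ℂ) (M : Matrix m m ℂ) :
    trace (P * emb f M) = trace (ptr f P * M) := by
  simp only [trace, diag_apply, mul_apply]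
  rw [← Equiv.sum_comp f.symm, Fintype.sum_prod_type]
  refine Finset.sum_congr rfl fun i _ => ?_
  simp only [ptr, Matrix.of_apply, Finset.sum_mul]
  rw [Finset.sum_comm]
  rw [← Equiv.sum_comp f.symm, Fintype.sum_prod_type]
  refine Finset.sum_congr rfl fun j _ => ?_
  simp only [emb, submatrix_apply, Equiv.apply_symm_apply, kroneckerMap_apply]
  refine Finset.sum_congr rfl fun t _ => ?_
  rw [Finset.sum_eq_single t]
  · simp
  · intro b _ hb; rw [one_apply_ne hb.symm]; simp
  · simp

lemma trace_dfc {U : Matrix m m ℂ} (hU : Uᴴ * U = 1) (u : m → ℂ) :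
    trace (dfc U u) = ∑ i, u i := by
  rw [dfc, trace_mul_comm, ← Matrix.mul_assoc, hU, Matrix.one_mul, trace_diagonal]

lemma entropy_flat {ρ : Matrix m m ℂ} (h : ρ.IsHermitian) (kk : ℝ) (hk : 0 < kk)
    (h1 : ρ * ρ = ((kk⁻¹ : ℝ) : ℂ) • ρ) (h2 : trace ρ = 1) :
    ∑ i, Real.negMulLog (h.eigenvalues i) = Real.log kk := by
  set U := (h.eigenvectorUnitary : Matrix m m ℂ)
  set u := h.eigenvalues
  have hU : Uᴴ * U = 1 := eigU_left h
  have hd : ρ = dfc U (fun i => (u i : ℂ)) := herm_dfc h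
  have h3 : ∀ i, u i * u i = kk⁻¹ * u i := by
    intro i
    rw [hd, dfc_mul hU] at h1
    have h2 := congrArg (fun T => Uᴴ * T * U) h1
    simp only [Matrix.mul_smul, Matrix.smul_mul, dfc_inner hU] at h2
    have h3 := congrFun (congrFun h2 i) i
    simp only [diagonal_apply_eq, Matrix.smul_apply, smul_eq_mul] at h3
    exact_mod_cast h3
  have h4 : ∑ i, u i = 1 := by
    rw [hd, trace_dfc hU] at h2
    exact_mod_cast h2
  have h5 : ∀ i, Real.negMulLog (u i) = u i * Real.log kk := by
    intro i
    rcases eq_or_ne (u i) 0 with h | h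
    · rw [h]; simp
    · have : u i = kk⁻¹ := mul_right_cancel₀ h (h3 i)
      rw [this, Real.negMulLog, Real.log_inv]; ring
  rw [Finset.sum_congr rfl fun i _ => h5 i, ← Finset.sum_mul, h4, one_mul]

end emb


section four
variable {A B C D : Type*} [Fintype A] [Fintype B] [Fintype C] [Fintype D]
  [DecidableEq A] [DecidableEq B] [DecidableEq C] [DecidableEq D]

/-- regrouping -/
def fAC : (A × B) × C ≃ (A × C) × B where
  toFun p := ((p.1.1, p.2), p.1.2)
  invFun p := ((p.1.1, p.2), p.1.2)
  left_inv _ := rfl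
  right_inv _ := rfl

/-- regrouping -/
def fBC : (A × B) × C ≃ (B × C) × A where
  toFun p := ((p.1.2, p.2), p.1.1)
  invFun p := ((p.2, p.1.1), p.1.2)
  left_inv _ := rfl
  right_inv _ := rfl

variable (ψ : (A × B) × C × D → ℂ)

/-- the state as a matrix from D -/
def Vm : Matrix ((A × B) × C) D ℂ := Matrix.of fun p δ => ψ (p.1, (p.2, δ))

lemma redDM_herm {X Y : Type*} [Fintype Y] (φ : X × Y → ℂ) : (redDM φ).IsHermitian := by
  ext i j
  simp [redDM, conjTranspose_apply, mul_comm]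

lemma redDM_psd {X Y : Type*} [Fintype X] [Fintype Y] (φ : X × Y → ℂ) : (redDM φ).PosSemidef := by
  have : redDM φ = (Matrix.of fun x y => φ (x, y) : Matrix X Y ℂ) *
      (Matrix.of fun x y => φ (x, y) : Matrix X Y ℂ)ᴴ := by
    ext i j; simp [redDM, mul_apply]
  rw [this]
  exact posSemidef_self_mul_conjTranspose _

lemma rhoABC_eq : rhoABC ψ = Vm ψ * (Vm ψ)ᴴ := by
  ext i j; simp [rhoABC, redDM, Vm, mul_apply]

lemma ptr_AC : ptr fAC (rhoABC ψ) = rhoAC ψ := by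
  ext i j
  simp only [ptr, rhoABC, rhoAC, redDM, Matrix.of_apply, Fintype.sum_prod_type]
  rfl

lemma ptr_BC : ptr fBC (rhoABC ψ) = rhoBC ψ := by
  ext i j
  simp only [ptr, rhoABC, rhoBC, redDM, Matrix.of_apply, Fintype.sum_prod_type]
  rfl

lemma sum_rhoAC (γ γ' : C) : ∑ a, rhoAC ψ (a, γ) (a, γ') = rhoC ψ γ γ' := by
  simp only [rhoAC, rhoC, redDM, Matrix.of_apply, Fintype.sum_prod_type]

lemma ptr_emb {l : ℂ} (hC : rhoC ψ = l • 1) :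
    ptr (fBC (A := A) (B := B) (C := C)) (emb fAC (rhoAC ψ)) = l • 1 := by
  ext ⟨b, γ⟩ ⟨b', γ'⟩
  have := sum_rhoAC ψ γ γ'
  rw [hC] at this
  simp only [ptr, Matrix.of_apply, emb, submatrix_apply, fBC, fAC, Equiv.coe_fn_mk,
    Equiv.coe_fn_symm_mk, kroneckerMap_apply, ← Finset.sum_mul, this, Matrix.smul_apply, one_apply,
    smul_eq_mul, Prod.mk.injEq]
  split_ifs <;> simp_all





lemma VV (hR : ∀ y y' : C × D, ∑ x, star (ψ (x, y)) * ψ (x, y') =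
      if y = y' then ((Fintype.card C : ℂ) * Fintype.card D)⁻¹ else 0) [Nonempty C] :
    (Vm ψ)ᴴ * Vm ψ = (Fintype.card D : ℂ)⁻¹ • 1 := by
  ext δ δ'
  have hc : (Fintype.card C : ℂ) ≠ 0 := by exact_mod_cast Fintype.card_ne_zero
  simp only [mul_apply, conjTranspose_apply, Vm, Matrix.of_apply, Fintype.sum_prod_type_right,
    Matrix.smul_apply, one_apply, smul_eq_mul]
  have : ∀ γ : C, ∑ y : B, ∑ x : A, star (ψ ((x, y), γ, δ)) * ψ ((x, y), γ, δ') =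
      if δ = δ' then ((Fintype.card C : ℂ) * Fintype.card D)⁻¹ else 0 := by
    intro γ
    have := hR (γ, δ) (γ, δ')
    rw [Fintype.sum_prod_type_right] at this
    rw [this]; simp
  rw [Finset.sum_congr rfl fun γ _ => this γ]
  simp only [Finset.sum_const, Finset.card_univ, nsmul_eq_mul]
  split_ifs
  · field_simp
  · simp

lemma rhoC_eq (hR : ∀ y y' : C × D, ∑ x, star (ψ (x, y)) * ψ (x, y') =
      if y = y' then ((Fintype.card C : ℂ) * Fintype.card D)⁻¹ else 0) [Nonempty D] :
    rhoC ψ = (Fintype.card C : ℂ)⁻¹ • 1 := by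
  ext γ γ'
  have hc : (Fintype.card D : ℂ) ≠ 0 := by exact_mod_cast Fintype.card_ne_zero
  simp only [rhoC, redDM, Matrix.of_apply, Fintype.sum_prod_type_right,
    Matrix.smul_apply, one_apply, smul_eq_mul]
  have : ∀ δ : D, ∑ y : B, ∑ x : A, ψ ((x, y), γ, δ) * star (ψ ((x, y), γ', δ)) =
      if γ = γ' then ((Fintype.card C : ℂ) * Fintype.card D)⁻¹ else 0 := by
    intro δ
    have := hR (γ', δ) (γ, δ)
    rw [Fintype.sum_prod_type_right] at this
    simp only [mul_comm (star _)] at this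
    rw [this]; simp [eq_comm]
  rw [Finset.sum_congr rfl fun γ _ => this γ]
  simp only [Finset.sum_const, Finset.card_univ, nsmul_eq_mul]
  split_ifs
  · field_simp
  · simp

lemma part4 (hR : ∀ y y' : C × D, ∑ x, star (ψ (x, y)) * ψ (x, y') =
      if y = y' then ((Fintype.card C : ℂ) * Fintype.card D)⁻¹ else 0)
    [Nonempty C] [Nonempty D] (hcmi : cmiAB_C ψ = 0) :
    rhoABC ψ = (Fintype.card C : ℂ) • (emb fAC (rhoAC ψ) * emb fBC (rhoBC ψ)) ∧
    rhoABC ψ = (Fintype.card C : ℂ) • (emb fBC (rhoBC ψ) * emb fAC (rhoAC ψ)) := by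
  obtain ⟨d, hd⟩ : ∃ d : ℝ, d = (Fintype.card D : ℝ) := ⟨_, rfl⟩
  obtain ⟨c, hc⟩ : ∃ c : ℝ, c = (Fintype.card C : ℝ) := ⟨_, rfl⟩
  have hdpos : 0 < d := by rw [hd]; exact_mod_cast Fintype.card_pos
  have hcpos : 0 < c := by rw [hc]; exact_mod_cast Fintype.card_pos
  have hdC : (d : ℂ) ≠ 0 := by exact_mod_cast hdpos.ne'
  have hcC : (c : ℂ) ≠ 0 := by exact_mod_cast hcpos.ne'
  have hdc : (Fintype.card D : ℂ) = (d : ℂ) := by simp [hd]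
  have hcc : (Fintype.card C : ℂ) = (c : ℂ) := by simp [hc]
  have hVV := VV ψ hR
  have hCC := rhoC_eq ψ hR
  rw [hdc] at hVV
  rw [hcc] at hCC ⊢
  set R := rhoABC ψ with hRdef
  have hRV : R = Vm ψ * (Vm ψ)ᴴ := rhoABC_eq ψ
  have hRH : R.IsHermitian := redDM_herm _
  have hRR : R * R = ((d⁻¹ : ℝ) : ℂ) • R := by
    have : R * R = Vm ψ * ((Vm ψ)ᴴ * Vm ψ) * (Vm ψ)ᴴ := by rw [hRV]; simp only [Matrix.mul_assoc]
    rw [this, hVV, Matrix.mul_smul, Matrix.mul_one, Matrix.smul_mul, ← hRV]; simp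
  have hRt : trace R = 1 := by
    rw [hRV, trace_mul_comm, hVV, trace_smul, trace_one, hdc, smul_eq_mul, inv_mul_cancel₀ hdC]
  have hACH : (rhoAC ψ).IsHermitian := redDM_herm _
  have hBCH : (rhoBC ψ).IsHermitian := redDM_herm _
  have hCH : (rhoC ψ).IsHermitian := redDM_herm _
  have hACp : (rhoAC ψ).PosSemidef := redDM_psd _
  have hBCp : (rhoBC ψ).PosSemidef := redDM_psd _
  have hACt : trace (rhoAC ψ) = 1 := by
    have := trace_emb fAC R (1 : Matrix (A × C) (A × C) ℂ)
    rw [emb_one, Matrix.mul_one, Matrix.mul_one, ptr_AC, hRt] at this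
    exact this.symm
  have hBCt : trace (rhoBC ψ) = 1 := by
    have := trace_emb fBC R (1 : Matrix (B × C) (B × C) ℂ)
    rw [emb_one, Matrix.mul_one, Matrix.mul_one, ptr_BC, hRt] at this
    exact this.symm
  have hSABC := entropy_flat hRH d hdpos hRR hRt
  have hSC := entropy_flat hCH c hcpos (by
    rw [hCC, Matrix.smul_mul, Matrix.one_mul]; simp) (by
    rw [hCC, trace_smul, trace_one, hcc, smul_eq_mul, inv_mul_cancel₀ hcC])
  have hlog2 : Real.log 2 ≠ 0 := (Real.log_pos one_lt_two).ne'
  have hS : ∑ i, Real.negMulLog (hACH.eigenvalues i) + ∑ i, Real.negMulLog (hBCH.eigenvalues i)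
      = Real.log c + Real.log d := by
    simp only [cmiAB_C, SAC, SBC, SC, SABC, vNE] at hcmi
    rw [dif_pos hACH, dif_pos hBCH, dif_pos hCH, dif_pos hRH, hSABC, hSC] at hcmi
    field_simp at hcmi
    linarith
  set U := (hACH.eigenvectorUnitary : Matrix (A × C) (A × C) ℂ)
  set W := (hBCH.eigenvectorUnitary : Matrix (B × C) (B × C) ℂ)
  set x := hACH.eigenvalues
  set y := hBCH.eigenvalues
  have hU : Uᴴ * U = 1 := eigU_left hACH
  have hW : Wᴴ * W = 1 := eigU_left hBCH
  have hAd : rhoAC ψ = dfc U (fun i => (x i : ℂ)) := herm_dfc hACH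
  have hBd : rhoBC ψ = dfc W (fun i => (y i : ℂ)) := herm_dfc hBCH
  have hx : ∀ i, 0 ≤ x i := fun i => hACp.eigenvalues_nonneg i
  have hy : ∀ i, 0 ≤ y i := fun i => hBCp.eigenvalues_nonneg i
  have f0 : ∀ t : ℝ, (t : ℂ) * fpow t 0 = t := by
    intro t
    rcases eq_or_ne t 0 with h | h
    · simp [h]
    · simp [fpow, h]
  have hAt : ∀ u : A × C → ℂ, trace ((d : ℂ) • R * dfc (emb fAC U) (fun i => u (fAC i).1))
      = d * ∑ i, (x i : ℂ) * u i := by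
    intro u
    rw [← emb_dfc fAC U u, Matrix.smul_mul, trace_smul, trace_emb, ptr_AC, hAd, dfc_mul hU,
      trace_dfc hU, smul_eq_mul]
  have hBt : ∀ u : B × C → ℂ, trace ((d : ℂ) • R * dfc (emb fBC W) (fun i => u (fBC i).1))
      = d * ∑ i, (y i : ℂ) * u i := by
    intro u
    rw [← emb_dfc fBC W u, Matrix.smul_mul, trace_smul, trace_emb, ptr_BC, hBd, dfc_mul hW,
      trace_dfc hW, smul_eq_mul]
  have key := core' ((d : ℂ) • R) (emb (fAC (A := A) (B := B)) U) (emb fBC W)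
    (by rw [conjTranspose_smul, hRH.eq]; simp)
    (by rw [Matrix.smul_mul, Matrix.mul_smul, hRR, smul_smul, smul_smul]
        congr 1; push_cast; field_simp)
    c d hcpos hdpos (by rw [trace_smul, hRt]; simp)
    (by rw [← emb_conj, ← emb_mul, hU, emb_one]) (by rw [← emb_conj, ← emb_mul, hW, emb_one])
    (fun i => x (fAC i).1) (fun i => y (fBC i).1) (fun i => hx _) (fun i => hy _)
    (by
      rw [hAt (fun i => fpow (x i) 0)]
      simp only [f0]
      rw [hAd, trace_dfc hU] at hACt
      rw [hACt, mul_one])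
    (by
      rw [hBt (fun i => fpow (y i) 0)]
      simp only [f0]
      rw [hBd, trace_dfc hW] at hBCt
      rw [hBCt, mul_one])
    (by
      rw [← emb_dfc fAC U (fun i => (x i : ℂ)), ← emb_dfc fBC W (fun i => (y i : ℂ)), ← hAd, ← hBd,
        trace_emb, ptr_emb ψ hCC, Matrix.smul_mul, Matrix.one_mul, trace_smul, hBCt]
      simp)
    (by
      rw [hAt (fun i => (Real.log (x i) : ℂ)), hBt (fun i => (Real.log (y i) : ℂ))]
      rw [Real.log_mul hcpos.ne' hdpos.ne', ← hS]
      simp only [Real.negMulLog]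
      push_cast
      simp only [neg_mul, Finset.sum_neg_distrib]
      ring)
  rw [← emb_dfc fAC U (fun i => (x i : ℂ)), ← emb_dfc fBC W (fun i => (y i : ℂ)), ← hAd, ← hBd] at key
  have fin : ∀ T : Matrix ((A × B) × C) ((A × B) × C) ℂ, (d : ℂ) • R = ((c * d : ℝ) : ℂ) • T →
      R = (c : ℂ) • T := by
    intro T hT
    have := congrArg (fun Z => (d : ℂ)⁻¹ • Z) hT
    simp only [smul_smul, inv_mul_cancel₀ hdC, one_smul] at this
    rw [this]
    congr 1; push_cast; field_simp
  exact ⟨fin _ key.1, fin _ key.2⟩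

end four


section four2
variable {A B C D : Type*} [Fintype A] [Fintype B] [Fintype C] [Fintype D]
  [DecidableEq A] [DecidableEq B] [DecidableEq C] [DecidableEq D]

/-- block of an operator on a tensor product -/
def blk {X Y : Type*} (R : Matrix (X × Y) (X × Y) ℂ) (i j : X) : Matrix Y Y ℂ :=
  Matrix.of fun γ γ' => R (i, γ) (j, γ')

lemma blk_AB (X : Matrix (A × C) (A × C) ℂ) (Y : Matrix (B × C) (B × C) ℂ) (a a' : A) (b b' : B) :
    blk (emb fAC X * emb fBC Y) (a, b) (a', b') = blk X a a' * blk Y b b' := by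
  ext γ γ'
  simp only [blk, Matrix.of_apply, mul_apply, Fintype.sum_prod_type, emb, submatrix_apply,
    kroneckerMap_apply, fAC, fBC, Equiv.coe_fn_mk]
  rw [Finset.sum_eq_single a', Finset.sum_eq_single b]
  · simp
  · intro t _ ht; simp [one_apply_ne ht.symm]
  · simp
  · intro t _ ht; simp [one_apply_ne ht]
  · simp

lemma blk_BA (X : Matrix (A × C) (A × C) ℂ) (Y : Matrix (B × C) (B × C) ℂ) (a a' : A) (b b' : B) :
    blk (emb fBC Y * emb fAC X) (a, b) (a', b') = blk Y b b' * blk X a a' := by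
  ext γ γ'
  simp only [blk, Matrix.of_apply, mul_apply, Fintype.sum_prod_type, emb, submatrix_apply,
    kroneckerMap_apply, fAC, fBC, Equiv.coe_fn_mk]
  rw [Finset.sum_eq_single a, Finset.sum_eq_single b']
  · simp
  · intro t _ ht; simp [one_apply_ne ht]
  · simp
  · intro t _ ht; simp [one_apply_ne ht.symm]
  · simp

lemma blk_smul {X Y : Type*} (l : ℂ) (R : Matrix (X × Y) (X × Y) ℂ) (i j : X) :
    blk (l • R) i j = l • blk R i j := rfl

lemma blk_herm {X Y : Type*} {R : Matrix (X × Y) (X × Y) ℂ} (h : R.IsHermitian) (i j : X) :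
    (blk R i j)ᴴ = blk R j i := by
  ext γ γ'
  exact h.apply _ _

/-- the state as a family of C by D matrices -/
def Mm (ψ : (A × B) × C × D → ℂ) (i : A × B) : Matrix C D ℂ := Matrix.of fun γ δ => ψ (i, (γ, δ))

lemma blk_rho (ψ : (A × B) × C × D → ℂ) (i j : A × B) :
    blk (rhoABC ψ) i j = Mm ψ i * (Mm ψ j)ᴴ := by
  ext γ γ'
  simp [blk, rhoABC, redDM, Mm, mul_apply]

lemma irred (ψ : (A × B) × C × D → ℂ)
    (hR : ∀ y y' : C × D, ∑ x, star (ψ (x, y)) * ψ (x, y') =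
      if y = y' then ((Fintype.card C : ℂ) * Fintype.card D)⁻¹ else 0)
    [Nonempty C] [Nonempty D] (z : Matrix C C ℂ)
    (hz : ∀ i j, z * (Mm ψ i * (Mm ψ j)ᴴ) = Mm ψ i * (Mm ψ j)ᴴ * z) : ∃ l : ℂ, z = l • 1 := by
  have hd : (Fintype.card D : ℂ) ≠ 0 := by exact_mod_cast Fintype.card_ne_zero
  have hc : (Fintype.card C : ℂ) ≠ 0 := by exact_mod_cast Fintype.card_ne_zero
  have hs : ∑ j, (Mm ψ j)ᴴ * Mm ψ j = (Fintype.card D : ℂ)⁻¹ • 1 := by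
    rw [← VV ψ hR]
    ext δ δ'
    simp only [Matrix.sum_apply, mul_apply, conjTranspose_apply, Mm, Vm, Matrix.of_apply,
      Fintype.sum_prod_type]
  set z' : Matrix D D ℂ := (Fintype.card D : ℂ) • ∑ j, (Mm ψ j)ᴴ * z * Mm ψ j with hz'
  have h1 : ∀ i, z * Mm ψ i = Mm ψ i * z' := by
    intro i
    have h2 : z * Mm ψ i = (Fintype.card D : ℂ) • (z * Mm ψ i * ∑ j, (Mm ψ j)ᴴ * Mm ψ j) := by
      rw [hs, Matrix.mul_smul, smul_smul, mul_inv_cancel₀ hd, one_smul, Matrix.mul_one]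
    rw [h2, hz', Matrix.mul_smul, Matrix.mul_sum, Matrix.mul_sum]
    congr 1
    refine Finset.sum_congr rfl fun j _ => ?_
    have := congrArg (fun T => T * Mm ψ j) (hz i j)
    simpa only [Matrix.mul_assoc] using this
  have hE : ∀ (γ : C) (δ : D), z * Matrix.single γ δ (1 : ℂ) = Matrix.single γ δ (1 : ℂ) * z' := by
    intro γ δ
    have h3 : Matrix.single γ δ (1 : ℂ) =
        ∑ i, (((Fintype.card C : ℂ) * Fintype.card D) * star (ψ (i, (γ, δ)))) • Mm ψ i := by
      ext g e
      simp only [Matrix.sum_apply, Matrix.smul_apply, smul_eq_mul, Mm, Matrix.of_apply, mul_assoc,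
        ← Finset.mul_sum, hR, Matrix.single_apply, Prod.mk.injEq]
      split_ifs <;> simp_all
    rw [h3, Matrix.mul_sum, Matrix.sum_mul]
    refine Finset.sum_congr rfl fun i _ => ?_
    rw [Matrix.mul_smul, Matrix.smul_mul, h1]
  obtain ⟨δ⟩ := (inferInstance : Nonempty D)
  refine ⟨z' δ δ, ?_⟩
  ext g γ
  have := congrFun (congrFun (hE γ δ) g) δ
  simp only [mul_apply, Matrix.single_apply] at this
  rw [Finset.sum_eq_single γ (by intro b _ hb; simp [hb.symm]) (by simp),
    Finset.sum_eq_single δ (by intro b _ hb; simp [hb.symm]) (by simp)] at this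
  simp only [and_self, if_true, mul_one, and_true] at this
  rw [this, Matrix.smul_apply, one_apply, smul_eq_mul]
  by_cases h : γ = g
  · simp [h]
  · simp [h, Ne.symm h]

end four2


section five
variable {X Y D : Type*} [Fintype X] [Fintype Y] [Fintype D]
  [DecidableEq X] [DecidableEq Y] [DecidableEq D]

/-- trace out the second factor -/
def tr2 (R : Matrix (X × Y) (X × Y) ℂ) : Matrix X X ℂ := Matrix.of fun i j => ∑ t, R (i, t) (j, t)
/-- trace out the first factor -/
def tr1 (R : Matrix (X × Y) (X × Y) ℂ) : Matrix Y Y ℂ := Matrix.of fun i j => ∑ t, R (t, i) (t, j)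

lemma tr2_kron (S : Matrix X X ℂ) (T : Matrix Y Y ℂ) : tr2 (S ⊗ₖ T) = trace T • S := by
  ext i j
  simp [tr2, trace, Finset.mul_sum, mul_comm]

lemma tr1_kron (S : Matrix X X ℂ) (T : Matrix Y Y ℂ) : tr1 (S ⊗ₖ T) = trace S • T := by
  ext i j
  simp [tr1, trace, Finset.mul_sum, mul_comm]

lemma tr2_smul (l : ℂ) (R : Matrix (X × Y) (X × Y) ℂ) : tr2 (l • R) = l • tr2 R := by
  ext i j; simp [tr2, Finset.mul_sum]

lemma tr1_smul (l : ℂ) (R : Matrix (X × Y) (X × Y) ℂ) : tr1 (l • R) = l • tr1 R := by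
  ext i j; simp [tr1, Finset.mul_sum]

lemma tr2_herm {R : Matrix (X × Y) (X × Y) ℂ} (h : Rᴴ = R) : (tr2 R)ᴴ = tr2 R := by
  ext i j
  simp only [tr2, conjTranspose_apply, Matrix.of_apply, star_sum]
  exact Finset.sum_congr rfl fun t _ => congrFun (congrFun h _) _

lemma tr1_herm {R : Matrix (X × Y) (X × Y) ℂ} (h : Rᴴ = R) : (tr1 R)ᴴ = tr1 R := by
  ext i j
  simp only [tr1, conjTranspose_apply, Matrix.of_apply, star_sum]
  exact Finset.sum_congr rfl fun t _ => congrFun (congrFun h _) _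

lemma split_proj (K : Matrix (X × Y) D ℂ) (c : ℂ) (d : ℝ) (hd : 0 < d)
    (hdc : (Fintype.card D : ℂ) = d)
    (S : Matrix X X ℂ) (T : Matrix Y Y ℂ) (h1 : Kᴴ * K = (d : ℂ)⁻¹ • 1) (h2 : K * Kᴴ = c • (S ⊗ₖ T)) :
    ∃ (q s : ℕ) (F : Matrix X (Fin q) ℂ) (G : Matrix Y (Fin s) ℂ) (Z : Matrix (Fin q × Fin s) D ℂ),
      Z * Zᴴ = 1 ∧ Zᴴ * Z = 1 ∧ K = ((Real.sqrt d : ℝ) : ℂ)⁻¹ • ((F ⊗ₖ G) * Z) := by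
  have hdC : (d : ℂ) ≠ 0 := by exact_mod_cast hd.ne'
  set R := K * Kᴴ with hR
  have hRH : Rᴴ = R := by rw [hR, conjTranspose_mul, conjTranspose_conjTranspose]
  have hRt : trace R = 1 := by
    rw [hR, trace_mul_comm, h1, trace_smul, trace_one, hdc, smul_eq_mul, inv_mul_cancel₀ hdC]
  have hRR : R * R = (d : ℂ)⁻¹ • R := by
    have : R * R = K * (Kᴴ * K) * Kᴴ := by simp only [hR, Matrix.mul_assoc]
    rw [this, h1, Matrix.mul_smul, Matrix.mul_one, Matrix.smul_mul]
  have hc1 : c * (trace S * trace T) = 1 := by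
    rw [← hRt, h2, trace_smul, trace_kronecker, smul_eq_mul]
  set P0 := tr2 R with hP0
  set Q0 := tr1 R with hQ0
  have hP0H : P0ᴴ = P0 := tr2_herm hRH
  have hQ0H : Q0ᴴ = Q0 := tr1_herm hRH
  have hP0e : P0 = (c * trace T) • S := by rw [hP0, h2, tr2_smul, tr2_kron, smul_smul]
  have hQ0e : Q0 = (c * trace S) • T := by rw [hQ0, h2, tr1_smul, tr1_kron, smul_smul]
  have hRPQ : R = P0 ⊗ₖ Q0 := by
    rw [hP0e, hQ0e, smul_kronecker, kronecker_smul, smul_smul, h2]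
    congr 1
    linear_combination (-c) * hc1
  have hP0t : trace P0 = 1 := by
    rw [hP0e, trace_smul, smul_eq_mul]; linear_combination hc1
  have hQ0t : trace Q0 = 1 := by
    rw [hQ0e, trace_smul, smul_eq_mul]; linear_combination hc1
  set ν := trace (Q0 * Q0) with hν
  set μ := trace (P0 * P0) with hμ
  have hkk : (P0 * P0) ⊗ₖ (Q0 * Q0) = (d : ℂ)⁻¹ • (P0 ⊗ₖ Q0) := by
    rw [mul_kronecker_mul, ← hRPQ, hRR]
  have e1 : ν • (P0 * P0) = (d : ℂ)⁻¹ • P0 := by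
    have := congrArg tr2 hkk
    rwa [tr2_kron, tr2_smul, tr2_kron, hQ0t, one_smul] at this
  have e2 : μ • (Q0 * Q0) = (d : ℂ)⁻¹ • Q0 := by
    have := congrArg tr1 hkk
    rwa [tr1_kron, tr1_smul, tr1_kron, hP0t, one_smul] at this
  have e3 : ν * μ = (d : ℂ)⁻¹ := by
    have := congrArg trace e1
    rwa [trace_smul, trace_smul, hP0t, smul_eq_mul, smul_eq_mul, mul_one] at this
  have e4 : (d : ℂ) * ν * μ = 1 := by rw [mul_assoc, e3, mul_inv_cancel₀ hdC]
  have hν0 : ν ≠ 0 := by intro h; rw [h] at e4; simp at e4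
  have hνs : star ν = ν := by
    rw [hν, ← trace_conjTranspose, conjTranspose_mul, hQ0H]
  have hμs : star μ = μ := by
    rw [hμ, ← trace_conjTranspose, conjTranspose_mul, hP0H]
  obtain ⟨q, F, hF1, hF2⟩ := proj_factor (P := ((d : ℂ) * ν) • P0)
    (by rw [conjTranspose_smul, hP0H, star_mul', hνs]; simp)
    (by
      rw [Matrix.smul_mul, Matrix.mul_smul, smul_smul]
      have : ((d : ℂ) * ν * ((d : ℂ) * ν)) • (P0 * P0) = ((d : ℂ) * ν * d) • (ν • (P0 * P0)) := by
        rw [smul_smul]; congr 1; ring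
      rw [this, e1, smul_smul]; congr 1; field_simp)
  obtain ⟨s, G, hG1, hG2⟩ := proj_factor (P := ((d : ℂ) * μ) • Q0)
    (by rw [conjTranspose_smul, hQ0H, star_mul', hμs]; simp)
    (by
      rw [Matrix.smul_mul, Matrix.mul_smul, smul_smul]
      have : ((d : ℂ) * μ * ((d : ℂ) * μ)) • (Q0 * Q0) = ((d : ℂ) * μ * d) • (μ • (Q0 * Q0)) := by
        rw [smul_smul]; congr 1; ring
      rw [this, e2, smul_smul]; congr 1; field_simp)
  set H := F ⊗ₖ G with hH
  have hH1 : Hᴴ * H = 1 := by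
    rw [hH, conjTranspose_kronecker, ← mul_kronecker_mul, hF1, hG1, one_kronecker_one]
  have hH2 : H * Hᴴ = (d : ℂ) • R := by
    rw [hH, conjTranspose_kronecker, ← mul_kronecker_mul, hF2, hG2, smul_kronecker, kronecker_smul,
      ← hRPQ, smul_smul]
    congr 1
    linear_combination (d : ℂ) * e4
  have hsq : ((Real.sqrt d : ℝ) : ℂ) * ((Real.sqrt d : ℝ) : ℂ) = d := by
    rw [← Complex.ofReal_mul, Real.mul_self_sqrt hd.le]
  have hs0 : ((Real.sqrt d : ℝ) : ℂ) ≠ 0 := by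
    exact_mod_cast (Real.sqrt_pos.mpr hd).ne'
  have hHK : H * (Hᴴ * K) = K := by
    rw [← Matrix.mul_assoc, hH2, hR, Matrix.smul_mul, Matrix.mul_assoc, h1, Matrix.mul_smul,
      Matrix.mul_one, smul_smul, mul_inv_cancel₀ hdC, one_smul]
  refine ⟨q, s, F, G, ((Real.sqrt d : ℝ) : ℂ) • (Hᴴ * K), ?_, ?_, ?_⟩
  · rw [conjTranspose_smul, Matrix.smul_mul, Matrix.mul_smul, smul_smul]
    have : Hᴴ * K * (Hᴴ * K)ᴴ = Hᴴ * R * H := by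
      rw [conjTranspose_mul, conjTranspose_conjTranspose]; simp only [hR, Matrix.mul_assoc]
    have h5 : (d : ℂ) • (Hᴴ * R * H) = 1 := by
      have : (d : ℂ) • (Hᴴ * R * H) = Hᴴ * ((d : ℂ) • R) * H := by
        rw [Matrix.mul_smul, Matrix.smul_mul]
      rw [this, ← hH2, ← Matrix.mul_assoc, hH1, Matrix.one_mul, hH1]
    rw [this, ← h5]
    congr 1
    simpa using hsq
  · rw [conjTranspose_smul, Matrix.smul_mul, Matrix.mul_smul, smul_smul]
    have : (Hᴴ * K)ᴴ * (Hᴴ * K) = Kᴴ * (H * (Hᴴ * K)) := by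
      rw [conjTranspose_mul, conjTranspose_conjTranspose]; simp only [Matrix.mul_assoc]
    rw [this, hHK, h1, smul_smul]
    have : star ((Real.sqrt d : ℝ) : ℂ) * ((Real.sqrt d : ℝ) : ℂ) * (d : ℂ)⁻¹ = 1 := by
      have : star ((Real.sqrt d : ℝ) : ℂ) = ((Real.sqrt d : ℝ) : ℂ) := by simp
      rw [this, hsq, mul_inv_cancel₀ hdC]
    rw [this, one_smul]
  · rw [Matrix.mul_smul, smul_smul, inv_mul_cancel₀ hs0, one_smul, hHK]

lemma kron_scal [Nonempty X] [Nonempty Y] {S : Matrix X X ℂ} {T : Matrix Y Y ℂ} {κ : ℂ} (hκ : κ ≠ 0)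
    (h : S ⊗ₖ T = κ • 1) : ∃ s t : ℂ, S = s • 1 ∧ T = t • 1 ∧ s * t = κ := by
  obtain ⟨x0⟩ := (inferInstance : Nonempty X)
  obtain ⟨y0⟩ := (inferInstance : Nonempty Y)
  have he : ∀ x x' y y', S x x' * T y y' = if x = x' ∧ y = y' then κ else 0 := by
    intro x x' y y'
    have := congrFun (congrFun h (x, y)) (x', y')
    rw [kroneckerMap_apply, Matrix.smul_apply, one_apply, smul_eq_mul] at this
    rw [this]
    simp [Prod.mk.injEq]
  have h0 : S x0 x0 * T y0 y0 = κ := by rw [he]; simp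
  have hT : T y0 y0 ≠ 0 := by intro h; rw [h, mul_zero] at h0; exact hκ h0.symm
  have hS : S x0 x0 ≠ 0 := by intro h; rw [h, zero_mul] at h0; exact hκ h0.symm
  refine ⟨S x0 x0, T y0 y0, ?_, ?_, h0⟩
  · ext x x'
    apply mul_right_cancel₀ hT
    rw [he, Matrix.smul_apply, one_apply]
    split_ifs <;> simp_all
  · ext x x'
    apply mul_left_cancel₀ hS
    rw [he, Matrix.smul_apply, one_apply]
    split_ifs <;> simp_all

lemma scal_unitary [Nonempty X] {F : Matrix X Y ℂ} {s s' : ℂ} (h1 : F * Fᴴ = s • 1)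
    (h2 : Fᴴ * F = s' • 1) (hs : s ≠ 0) : ∃ (f : ℝ) (U : Matrix X Y ℂ), U * Uᴴ = 1 ∧ Uᴴ * U = 1 ∧
      F = (f : ℂ) • U ∧ (f : ℂ) * f = s := by
  obtain ⟨x0⟩ := (inferInstance : Nonempty X)
  have hp := (posSemidef_self_mul_conjTranspose F).diag_nonneg (i := x0)
  rw [h1, Matrix.smul_apply, one_apply_eq, smul_eq_mul, mul_one] at hp
  obtain ⟨t, ht, rfl⟩ : ∃ t : ℝ, 0 ≤ t ∧ (t : ℂ) = s :=
    ⟨s.re, (Complex.nonneg_iff.mp hp).1, Complex.ext (by simp) (by simpa using (Complex.nonneg_iff.mp hp).2)⟩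
  have ht0 : 0 < t := lt_of_le_of_ne ht (by rintro rfl; simp at hs)
  have hF : F ≠ 0 := by
    rintro rfl
    have := congrFun (congrFun h1 x0) x0
    simp at this
    exact hs (by rw [← this])
  have hss : s' = t := by
    have : (t : ℂ) • F = s' • F := by
      have : F * Fᴴ * F = F * (Fᴴ * F) := Matrix.mul_assoc _ _ _
      rwa [h1, h2, Matrix.smul_mul, Matrix.mul_smul, Matrix.one_mul, Matrix.mul_one] at this
    have h3 : ((t : ℂ) - s') • F = 0 := by rw [sub_smul, this, sub_self]
    rcases smul_eq_zero.mp h3 with h | h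
    · exact (sub_eq_zero.mp h).symm
    · exact absurd h hF
  have hsq : ((Real.sqrt t : ℝ) : ℂ) * ((Real.sqrt t : ℝ) : ℂ) = t := by
    rw [← Complex.ofReal_mul, Real.mul_self_sqrt ht0.le]
  have hs0 : ((Real.sqrt t : ℝ) : ℂ) ≠ 0 := by
    exact_mod_cast (Real.sqrt_pos.mpr ht0).ne'
  have hst : star (((Real.sqrt t : ℝ) : ℂ)⁻¹) = ((Real.sqrt t : ℝ) : ℂ)⁻¹ := by simp
  have hone : ((Real.sqrt t : ℝ) : ℂ)⁻¹ * ((Real.sqrt t : ℝ) : ℂ)⁻¹ * (t : ℂ) = 1 := by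
    rw [← hsq]; field_simp
  refine ⟨Real.sqrt t, ((Real.sqrt t : ℝ) : ℂ)⁻¹ • F, ?_, ?_, ?_, hsq⟩
  · rw [conjTranspose_smul, hst, Matrix.smul_mul, Matrix.mul_smul, h1, smul_smul, smul_smul, hone,
      one_smul]
  · rw [conjTranspose_smul, hst, Matrix.smul_mul, Matrix.mul_smul, h2, hss, smul_smul, smul_smul, hone,
      one_smul]
  · rw [smul_smul, mul_inv_cancel₀ hs0, one_smul]

lemma unitary_card {U : Matrix X Y ℂ} (h1 : U * Uᴴ = 1) (h2 : Uᴴ * U = 1) :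
    Fintype.card X = Fintype.card Y := by
  have := trace_mul_comm U Uᴴ
  rw [h1, h2, trace_one, trace_one] at this
  exact_mod_cast this

end five


section six

lemma pureDM_conj {T S : Type*} [Fintype T] [Fintype S] (K : Matrix S T ℂ) (ψ : T → ℂ) :
    K * pureDM ψ * Kᴴ = pureDM (K *ᵥ ψ) := by
  have h1 : pureDM ψ = vecMulVec ψ (star ψ) := rfl
  have h2 : pureDM (K *ᵥ ψ) = vecMulVec (K *ᵥ ψ) (star (K *ᵥ ψ)) := rfl
  rw [h1, h2, mul_vecMulVec, vecMulVec_mul, star_mulVec]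

variable {A B C D : Type*} [Fintype A] [Fintype B] [Fintype C] [Fintype D]
  [DecidableEq A] [DecidableEq B] [DecidableEq C] [DecidableEq D]

lemma kron_mulVec {S T : Type*} [Fintype S] [Fintype T] (P : Matrix S A ℂ) (Q : Matrix T B ℂ)
    (ψ : A × B → ℂ) (x : S) (y : T) :
    ((P ⊗ₖ Q) *ᵥ ψ) (x, y) = (P * (Matrix.of fun a b => ψ (a, b) : Matrix A B ℂ) * Qᵀ) x y := by
  simp only [mulVec, dotProduct, Fintype.sum_prod_type, kroneckerMap_apply, mul_apply,
    transpose_apply, Matrix.of_apply, Finset.sum_mul]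
  rw [Finset.sum_comm]
  exact Finset.sum_congr rfl fun b _ => Finset.sum_congr rfl fun a _ => by ring

/-- The structure of the state after using the zero conditional mutual information. -/
lemma structure_lemma (ψ : (A × B) × C × D → ℂ)
    (hR : ∀ y y' : C × D, ∑ x, star (ψ (x, y)) * ψ (x, y') =
      if y = y' then ((Fintype.card C : ℂ) * Fintype.card D)⁻¹ else 0)
    [Nonempty C] [Nonempty D] (hcmi : cmiAB_C ψ = 0) :
    ∃ (p q r s : ℕ) (VC : Matrix (Fin p × Fin r) C ℂ) (VD : Matrix (Fin q × Fin s) D ℂ)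
      (F : Matrix A (Fin p × Fin q) ℂ) (G : Matrix B (Fin r × Fin s) ℂ),
      IsUnitaryMat VC ∧ IsUnitaryMat VD ∧
      ∀ a b i j k l, ((Matrix.of fun x y => ψ (x, y) : Matrix (A × B) (C × D) ℂ) * (VC ⊗ₖ VD)ᵀ)
        (a, b) ((i, j), (k, l)) =
        ((Real.sqrt (Fintype.card D) : ℝ) : ℂ)⁻¹ * (F a (i, k) * G b (j, l)) := by
  obtain ⟨h1, h2⟩ := part4 ψ hR hcmi
  have hc : (Fintype.card C : ℂ) ≠ 0 := by exact_mod_cast Fintype.card_ne_zero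
  have hd0 : (0 : ℝ) < Fintype.card D := by exact_mod_cast Fintype.card_pos
  have b1 : ∀ a b a' b', Mm ψ (a, b) * (Mm ψ (a', b'))ᴴ =
      (Fintype.card C : ℂ) • (blk (rhoAC ψ) a a' * blk (rhoBC ψ) b b') := by
    intro a b a' b'
    rw [← blk_rho, ← blk_AB, ← blk_smul, ← h1]
  have b2 : ∀ a b a' b', Mm ψ (a, b) * (Mm ψ (a', b'))ᴴ =
      (Fintype.card C : ℂ) • (blk (rhoBC ψ) b b' * blk (rhoAC ψ) a a') := by
    intro a b a' b'
    rw [← blk_rho, ← blk_BA, ← blk_smul, ← h2]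
  obtain ⟨p, r, W, hW1, hW2, x', y', hx', hy'⟩ := factor_lemma
    (fun i : A × A => blk (rhoAC ψ) i.1 i.2) (fun j : B × B => blk (rhoBC ψ) j.1 j.2)
    (fun i => ⟨(i.2, i.1), blk_herm (redDM_herm _) _ _⟩)
    (fun i => ⟨(i.2, i.1), blk_herm (redDM_herm _) _ _⟩)
    (fun i j => by
      have := (b1 i.1 j.1 i.2 j.2).symm.trans (b2 i.1 j.1 i.2 j.2)
      exact smul_right_injective _ hc this)
    (fun z hz1 hz2 => irred ψ hR z (by
      rintro ⟨a, b⟩ ⟨a', b'⟩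
      have e1 := hz1 (a, a')
      have e2 := hz2 (b, b')
      simp only at e1 e2
      rw [b1, Matrix.mul_smul, Matrix.smul_mul, ← Matrix.mul_assoc, e1, Matrix.mul_assoc, e2,
        Matrix.mul_assoc]))
  let K : Matrix ((A × Fin p) × (B × Fin r)) D ℂ :=
    Matrix.of fun u δ => (Wᴴ * Mm ψ (u.1.1, u.2.1)) (u.1.2, u.2.2) δ
  have hK1 : Kᴴ * K = ((Fintype.card D : ℝ) : ℂ)⁻¹ • 1 := by
    have e1 : Kᴴ * K = ∑ i : A × B, (Wᴴ * Mm ψ i)ᴴ * (Wᴴ * Mm ψ i) := by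
      ext δ δ'
      simp only [mul_apply (M := Kᴴ), Matrix.sum_apply, conjTranspose_apply, K, Matrix.of_apply,
        Fintype.sum_prod_type]
      simp only [mul_apply (N := Wᴴ * Mm ψ _), conjTranspose_apply, Fintype.sum_prod_type]
      refine Finset.sum_congr rfl fun a _ => ?_
      rw [Finset.sum_comm]
    have e2 : (Vm ψ)ᴴ * Vm ψ = ∑ i : A × B, (Mm ψ i)ᴴ * Mm ψ i := by
      ext δ δ'
      simp only [Matrix.sum_apply, mul_apply, conjTranspose_apply, Mm, Vm, Matrix.of_apply,
        Fintype.sum_prod_type]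
    have e3 := VV ψ hR
    rw [e2] at e3
    rw [e1, Complex.ofReal_natCast, ← e3]
    refine Finset.sum_congr rfl fun i _ => ?_
    rw [conjTranspose_mul, conjTranspose_conjTranspose, Matrix.mul_assoc, ← Matrix.mul_assoc W,
      hW2, Matrix.one_mul]
  have hK2 : K * Kᴴ = (Fintype.card C : ℂ) •
      ((Matrix.of fun u v => x' (u.1, v.1) u.2 v.2 : Matrix (A × Fin p) (A × Fin p) ℂ) ⊗ₖ
       (Matrix.of fun u v => y' (u.1, v.1) u.2 v.2 : Matrix (B × Fin r) (B × Fin r) ℂ)) := by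
    ext ⟨⟨a, i⟩, ⟨b, j⟩⟩ ⟨⟨a', i'⟩, ⟨b', j'⟩⟩
    have e1 : (Wᴴ * Mm ψ (a, b)) * (Wᴴ * Mm ψ (a', b'))ᴴ =
        (Fintype.card C : ℂ) • (x' (a, a') ⊗ₖ y' (b, b')) := by
      have e0 : (Wᴴ * Mm ψ (a, b)) * (Wᴴ * Mm ψ (a', b'))ᴴ =
          Wᴴ * (Mm ψ (a, b) * (Mm ψ (a', b'))ᴴ) * W := by
        rw [conjTranspose_mul, conjTranspose_conjTranspose]; simp only [Matrix.mul_assoc]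
      have e2 := hx' (a, a')
      have e3 := hy' (b, b')
      simp only at e2 e3
      have e4 : ∀ S T : Matrix (Fin p × Fin r) (Fin p × Fin r) ℂ,
          Wᴴ * ((W * S * Wᴴ) * (W * T * Wᴴ)) * W = S * T := by
        intro S T
        have : Wᴴ * ((W * S * Wᴴ) * (W * T * Wᴴ)) * W =
            (Wᴴ * W) * S * (Wᴴ * W) * T * (Wᴴ * W) := by simp only [Matrix.mul_assoc]
        rw [this, hW1]; simp
      rw [e0, b1, Matrix.mul_smul, Matrix.smul_mul, e2, e3, e4, ← mul_kronecker_mul, Matrix.mul_one,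
        Matrix.one_mul]
    have e2 := congrFun (congrFun e1 (i, j)) (i', j')
    rw [mul_apply] at e2 ⊢
    exact e2
  obtain ⟨q, s, F, G, Z, hZ1, hZ2, hKZ⟩ := split_proj K _ (Fintype.card D : ℝ) hd0 (by simp) _ _ hK1 hK2
  refine ⟨p, q, r, s, Wᴴ, Z.map star, Matrix.of fun a ik => F (a, ik.1) ik.2,
    Matrix.of fun b jl => G (b, jl.1) jl.2, ⟨by rw [conjTranspose_conjTranspose, hW1],
      by rw [conjTranspose_conjTranspose, hW2]⟩, ⟨?_, ?_⟩, ?_⟩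
  · have := congrArg (fun T => Tᵀ) hZ1
    ext i j
    have := congrFun (congrFun hZ1 j) i
    simp only [mul_apply, conjTranspose_apply, map_apply, star_star] at this ⊢
    rw [Finset.sum_congr rfl fun x _ => mul_comm _ _, this, one_apply, one_apply]
    simp [eq_comm]
  · ext i j
    have := congrFun (congrFun hZ2 j) i
    simp only [mul_apply, conjTranspose_apply, map_apply, star_star] at this ⊢
    rw [Finset.sum_congr rfl fun x _ => mul_comm _ _, this, one_apply, one_apply]
    simp [eq_comm]
  · intro a b i j k l
    have hKZ' : K * Zᴴ = ((Real.sqrt (Fintype.card D) : ℝ) : ℂ)⁻¹ • (F ⊗ₖ G) := by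
      rw [hKZ, Matrix.smul_mul, Matrix.mul_assoc, hZ1, Matrix.mul_one]
    have e := congrFun (congrFun hKZ' ((a, i), (b, j))) (k, l)
    rw [Matrix.smul_apply, smul_eq_mul, kroneckerMap_apply] at e
    simp only [Matrix.of_apply]
    rw [← e, mul_apply, mul_apply, Fintype.sum_prod_type_right]
    refine Finset.sum_congr rfl fun δ _ => ?_
    simp only [K, Matrix.of_apply, mul_apply, Finset.sum_mul, Mm, transpose_apply, kroneckerMap_apply,
      conjTranspose_apply, map_apply]
    exact Finset.sum_congr rfl fun γ _ => by ring

end six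

/-- Any pure four-party state with `I(A;B|C) = 0`, maximally mixed
marginal on `AB`, and `|A||B| = |C||D|` is, up to local unitary basis changes, a tensor
product of four maximally entangled pairs. -/
theorem zero_cmi_normal_form (a b c d : ℕ) (hdim : a * b = c * d)
    (ψ : (Fin a × Fin b) × Fin c × Fin d → ℂ)
    (hnorm : ∑ x, Complex.normSq (ψ x) = 1)
    (hcmi : cmiAB_C ψ = 0)
    (hmix : rhoAB ψ = mmState (Fin a × Fin b)) :
    ∃ p q r s : ℕ, a = p * q ∧ b = r * s ∧ c = p * r ∧ d = q * s ∧
      ∃ (VA : Matrix (Fin p × Fin q) (Fin a) ℂ) (VB : Matrix (Fin r × Fin s) (Fin b) ℂ)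
        (VC : Matrix (Fin p × Fin r) (Fin c) ℂ) (VD : Matrix (Fin q × Fin s) (Fin d) ℂ),
        IsUnitaryMat VA ∧ IsUnitaryMat VB ∧ IsUnitaryMat VC ∧ IsUnitaryMat VD ∧
        ((VA ⊗ₖ VB) ⊗ₖ (VC ⊗ₖ VD)) * pureDM ψ * ((VA ⊗ₖ VB) ⊗ₖ (VC ⊗ₖ VD))ᴴ
          = fourEPR p q r s := by
  have hne : Nonempty ((Fin a × Fin b) × Fin c × Fin d) := by
    by_contra h
    rw [not_nonempty_iff] at h
    rw [Finset.univ_eq_empty, Finset.sum_empty] at hnorm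
    exact zero_ne_one hnorm
  obtain ⟨⟨⟨a0, b0⟩, ⟨c0, d0⟩⟩⟩ := hne
  haveI : Nonempty (Fin a) := ⟨a0⟩
  haveI : Nonempty (Fin b) := ⟨b0⟩
  haveI : Nonempty (Fin c) := ⟨c0⟩
  haveI : Nonempty (Fin d) := ⟨d0⟩
  have ha : 0 < a := a0.pos
  have hb : 0 < b := b0.pos
  have hc : 0 < c := c0.pos
  have hd : 0 < d := d0.pos
  have haC : (a : ℂ) ≠ 0 := by exact_mod_cast ha.ne'
  have hbC : (b : ℂ) ≠ 0 := by exact_mod_cast hb.ne'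
  have hdC : (d : ℂ) ≠ 0 := by exact_mod_cast hd.ne'
  have hdimC : (a : ℂ) * b = (c : ℂ) * d := by exact_mod_cast hdim
  set Ψ : Matrix (Fin a × Fin b) (Fin c × Fin d) ℂ := Matrix.of fun x y => ψ (x, y) with hΨ
  have hm1 : Ψ * Ψᴴ = ((a : ℂ) * b)⁻¹ • 1 := by
    have e : rhoAB ψ = Ψ * Ψᴴ := by
      ext i j; simp [rhoAB, redDM, hΨ, mul_apply]
    rw [← e, hmix, mmState]; simp
  have hm2 : Ψᴴ * Ψ = ((a : ℂ) * b)⁻¹ • 1 := by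
    have e1 : (((a : ℂ) * b) • Ψ) * Ψᴴ = 1 := by
      rw [Matrix.smul_mul, hm1, smul_smul, mul_inv_cancel₀ (mul_ne_zero haC hbC), one_smul]
    have e2 : Ψᴴ * (((a : ℂ) * b) • Ψ) = 1 :=
      (Matrix.mul_eq_one_comm_of_equiv (Fintype.equivOfCardEq (by simpa using hdim))).mp e1
    rw [Matrix.mul_smul] at e2
    rw [← e2, smul_smul, inv_mul_cancel₀ (mul_ne_zero haC hbC), one_smul]
  have hR : ∀ y y' : Fin c × Fin d, ∑ x, star (ψ (x, y)) * ψ (x, y') =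
      if y = y' then ((Fintype.card (Fin c) : ℂ) * Fintype.card (Fin d))⁻¹ else 0 := by
    intro y y'
    have e := congrFun (congrFun hm2 y) y'
    rw [mul_apply, Matrix.smul_apply, one_apply, hdimC] at e
    simp only [Fintype.card_fin]
    simpa [hΨ] using e
  obtain ⟨p, q, r, s, VC, VD, F, G, hVC, hVD, hFG⟩ := structure_lemma ψ hR hcmi
  simp only [Fintype.card_fin] at hFG
  set w : ℂ := ((Real.sqrt d : ℝ) : ℂ)⁻¹ with hw
  have hws : star w = w := by simp [hw]
  have hww : w * w = (d : ℂ)⁻¹ := by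
    rw [hw, ← mul_inv, ← Complex.ofReal_mul, Real.mul_self_sqrt (by positivity)]; simp
  set V := VC ⊗ₖ VD with hV
  have hV1 : V * Vᴴ = 1 := by
    rw [hV, conjTranspose_kronecker, ← mul_kronecker_mul, hVC.1, hVD.1, one_kronecker_one]
  have hV2 : Vᴴ * V = 1 := by
    rw [hV, conjTranspose_kronecker, ← mul_kronecker_mul, hVC.2, hVD.2, one_kronecker_one]
  have hVt1 : Vᵀ * (Vᵀ)ᴴ = 1 := by
    rw [show (Vᵀ)ᴴ = (Vᴴ)ᵀ from rfl, ← transpose_mul, hV2, transpose_one]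
  have hVt2 : (Vᵀ)ᴴ * Vᵀ = 1 := by
    rw [show (Vᵀ)ᴴ = (Vᴴ)ᵀ from rfl, ← transpose_mul, hV1, transpose_one]
  let f : (Fin p × Fin q) × (Fin r × Fin s) ≃ (Fin p × Fin r) × (Fin q × Fin s) :=
    Equiv.prodProdProdComm _ _ _ _
  have hFG' : (Ψ * Vᵀ).submatrix id f = w • (F ⊗ₖ G) := by
    ext ⟨x, y⟩ ⟨⟨i, k⟩, ⟨j, l⟩⟩
    exact hFG x y i j k l
  have hk1 : (F * Fᴴ) ⊗ₖ (G * Gᴴ) = ((d : ℂ) * ((a : ℂ) * b)⁻¹) • 1 := by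
    have e1 : (Ψ * Vᵀ) * (Ψ * Vᵀ)ᴴ = ((a : ℂ) * b)⁻¹ • 1 := by
      rw [conjTranspose_mul, Matrix.mul_assoc, ← Matrix.mul_assoc Vᵀ, hVt1, Matrix.one_mul, hm1]
    have e2 : (Ψ * Vᵀ).submatrix id f * ((Ψ * Vᵀ).submatrix id f)ᴴ = ((a : ℂ) * b)⁻¹ • 1 := by
      rw [conjTranspose_submatrix, submatrix_mul_equiv, e1]; rfl
    rw [hFG', conjTranspose_smul, hws, Matrix.smul_mul, Matrix.mul_smul, smul_smul, hww,
      conjTranspose_kronecker, ← mul_kronecker_mul] at e2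
    rw [mul_smul, ← e2, smul_smul, mul_inv_cancel₀ hdC, one_smul]
  have hk2 : (Fᴴ * F) ⊗ₖ (Gᴴ * G) = ((d : ℂ) * ((a : ℂ) * b)⁻¹) • 1 := by
    have e1 : (Ψ * Vᵀ)ᴴ * (Ψ * Vᵀ) = ((a : ℂ) * b)⁻¹ • 1 := by
      rw [conjTranspose_mul, Matrix.mul_assoc, ← Matrix.mul_assoc Ψᴴ, hm2, Matrix.smul_mul,
        Matrix.one_mul, Matrix.mul_smul, hVt2]
    have e2 : ((Ψ * Vᵀ).submatrix id f)ᴴ * (Ψ * Vᵀ).submatrix id f = ((a : ℂ) * b)⁻¹ • 1 := by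
      rw [conjTranspose_submatrix, ← submatrix_mul _ _ _ _ _ Function.bijective_id, e1,
        ← submatrix_one_equiv f]
      rfl
    rw [hFG', conjTranspose_smul, hws, Matrix.smul_mul, Matrix.mul_smul, smul_smul, hww,
      conjTranspose_kronecker, ← mul_kronecker_mul] at e2
    rw [mul_smul, ← e2, smul_smul, mul_inv_cancel₀ hdC, one_smul]
  have hκ : (d : ℂ) * ((a : ℂ) * b)⁻¹ ≠ 0 := mul_ne_zero hdC (inv_ne_zero (mul_ne_zero haC hbC))
  have hcc : c = p * r := by
    have := unitary_card hVC.1 hVC.2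
    simpa using this.symm
  have hdd : d = q * s := by
    have := unitary_card hVD.1 hVD.2
    simpa using this.symm
  have hp : 0 < p := Nat.pos_of_ne_zero (by rintro rfl; simp at hcc; omega)
  have hr : 0 < r := Nat.pos_of_ne_zero (by rintro rfl; simp at hcc; omega)
  have hq : 0 < q := Nat.pos_of_ne_zero (by rintro rfl; simp at hdd; omega)
  have hs : 0 < s := Nat.pos_of_ne_zero (by rintro rfl; simp at hdd; omega)
  haveI : Nonempty (Fin p) := ⟨⟨0, hp⟩⟩
  haveI : Nonempty (Fin q) := ⟨⟨0, hq⟩⟩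
  haveI : Nonempty (Fin r) := ⟨⟨0, hr⟩⟩
  haveI : Nonempty (Fin s) := ⟨⟨0, hs⟩⟩
  obtain ⟨s1, t1, hs1, ht1, hst1⟩ := kron_scal hκ hk1
  obtain ⟨s2, t2, hs2, ht2, hst2⟩ := kron_scal hκ hk2
  have hs10 : s1 ≠ 0 := by rintro rfl; simp at hst1; simp_all
  have ht10 : t1 ≠ 0 := by rintro rfl; simp at hst1; simp_all
  obtain ⟨f1, UA, hA1, hA2, hFA, hf1⟩ := scal_unitary hs1 hs2 hs10
  obtain ⟨g1, UB, hB1, hB2, hGB, hg1⟩ := scal_unitary ht1 ht2 ht10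
  have haa : a = p * q := by simpa using unitary_card hA1 hA2
  have hbb : b = r * s := by simpa using unitary_card hB1 hB2
  refine ⟨p, q, r, s, haa, hbb, hcc, hdd, UAᴴ, UBᴴ, VC, VD,
    ⟨by rw [conjTranspose_conjTranspose, hA2], by rw [conjTranspose_conjTranspose, hA1]⟩,
    ⟨by rw [conjTranspose_conjTranspose, hB2], by rw [conjTranspose_conjTranspose, hB1]⟩,
    hVC, hVD, ?_⟩
  rw [pureDM_conj]
  have hvec : ∀ i k j l i' j' k' l',
      (((UAᴴ ⊗ₖ UBᴴ) ⊗ₖ (VC ⊗ₖ VD)) *ᵥ ψ) (((i, k), (j, l)), ((i', j'), (k', l'))) =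
      w * (f1 * g1) * (if (i = i' ∧ k = k') ∧ (j = j' ∧ l = l') then 1 else 0) := by
    intro i k j l i' j' k' l'
    rw [kron_mulVec, Matrix.mul_assoc]
    have e1 : ((UAᴴ ⊗ₖ UBᴴ) * (Ψ * Vᵀ)).submatrix id f = (w * (f1 * g1)) • 1 := by
      have : ((UAᴴ ⊗ₖ UBᴴ) * (Ψ * Vᵀ)).submatrix id f =
          (UAᴴ ⊗ₖ UBᴴ) * (Ψ * Vᵀ).submatrix id f := by
        ext x y; rfl
      rw [this, hFG', hFA, hGB, smul_kronecker, kronecker_smul, Matrix.mul_smul, Matrix.mul_smul,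
        Matrix.mul_smul, ← mul_kronecker_mul, hA2, hB2, one_kronecker_one, smul_smul, smul_smul,
        mul_assoc]
    have e2 := congrFun (congrFun e1 ((i, k), (j, l))) ((i', k'), (j', l'))
    refine Eq.trans ?_ (e2.trans ?_)
    · rfl
    · rw [Matrix.smul_apply, one_apply, smul_eq_mul]
      simp only [Prod.mk.injEq]
  have hamp : (w * (f1 * g1)) * star (w * (f1 * g1)) =
      (p : ℂ)⁻¹ * (q : ℂ)⁻¹ * (r : ℂ)⁻¹ * (s : ℂ)⁻¹ := by
    have e1 : star (w * ((f1 : ℂ) * g1)) = w * (f1 * g1) := by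
      rw [star_mul', hws, star_mul']; simp
    have e2 : (w * (f1 * g1)) * (w * (f1 * g1)) = (w * w) * ((f1 * f1) * (g1 * g1)) := by ring
    rw [e1, e2, hww, hf1, hg1, hst1, haa, hbb, ← mul_assoc, inv_mul_cancel₀ hdC]
    push_cast
    rw [one_mul, mul_inv, mul_inv, mul_inv]
    ring
  ext ⟨⟨⟨i, k⟩, ⟨j, l⟩⟩, ⟨⟨i', j'⟩, ⟨k', l'⟩⟩⟩ ⟨⟨⟨x, y⟩, ⟨z, u⟩⟩, ⟨⟨x', z'⟩, ⟨y', u'⟩⟩⟩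
  simp only [pureDM, fourEPR, Matrix.of_apply, hvec, pairME, Fintype.card_fin]
  by_cases c1 : (i = i' ∧ k = k') ∧ (j = j' ∧ l = l')
  · by_cases c2 : (x = x' ∧ y = y') ∧ (z = z' ∧ u = u')
    · obtain ⟨⟨rfl, rfl⟩, rfl, rfl⟩ := c1
      obtain ⟨⟨rfl, rfl⟩, rfl, rfl⟩ := c2
      simp only [and_self, if_true, mul_one]
      exact hamp
    · rw [if_neg c2, mul_zero, star_zero, mul_zero]
      symm
      by_contra hne
      apply c2
      refine ⟨⟨?_, ?_⟩, ?_, ?_⟩ <;> (by_contra hx; apply hne; simp [hx])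
  · rw [if_neg c1, mul_zero, zero_mul]
    symm
    by_contra hne
    apply c1
    refine ⟨⟨?_, ?_⟩, ?_, ?_⟩ <;> (by_contra hx; apply hne; simp [hx])

end Scrambling

end
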